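/- arXiv:2109.13184 — 7 statements merged into one kernel-verified Lean document; each statement's English description precedes it below -/
import Mathlib

section
/- Let b(φ,φ*) = |sin(φ−φ*)|, let M > 0, f_0 = M/(2π) and μ > 0. Then the operator f ↦ μ ∂_φ² f + Q_M f on functions of φ ∈ 𝕋¹ is diagonalized by the trigonometric system: for every n ≥ 1, (μ ∂_φ² + Q_M)(cos(nφ)) = λ_n cos(nφ) and (μ ∂_φ² + Q_M)(sin(nφ)) = λ_n sin(nφ), where λ_1 = −μ − (f_0/3)(4√2 − 1), λ_2 = −4μ + 2f_0/3, and for n > 2, λ_n = −n²μ + 2f_0( (4n sin(nπ/4) − 8)/(n²−4) + (n sin(nπ/2) + (−1)ⁿ)/(n²−1) + (−1)ⁿ − 2 ). -/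
open MeasureTheory Real Filter

noncomputable section

/-- The myxobacteria collision operator for functions of the angle φ ∈ 𝕋¹
(represented by 2π-periodic functions on ℝ). -/
def Q1 (b : ℝ → ℝ → ℝ) (f g : ℝ → ℝ) (φ : ℝ) : ℝ :=
  2 * (∫ ψ in (φ - π/4)..(φ + π/4), b (2*φ - ψ) ψ * f (2*φ - ψ) * g ψ)
    + (∫ ψ in (φ + π/2)..(φ + 3*π/2), b (φ + π) (ψ + π) * f (φ + π) * g (ψ + π))
    - ∫ ψ in (0:ℝ)..(2*π), b φ ψ * f φ * g ψ

/-- The linearization Q_M f = Q(f₀,f) + Q(f,f₀) of Q around the uniform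
equilibrium f₀ = M/(2π). -/
def QM1 (b : ℝ → ℝ → ℝ) (M : ℝ) (f : ℝ → ℝ) : ℝ → ℝ :=
  fun φ => Q1 b (fun _ => M/(2*π)) f φ + Q1 b f (fun _ => M/(2*π)) φ

/-- The rod-shaped kernel b(φ,φ*) = |sin(φ-φ*)|. -/
def bsin : ℝ → ℝ → ℝ := fun φ ψ => |Real.sin (φ - ψ)|

/-- The eigenvalues λ_n of μ ∂φ² + Q_M on the trigonometric system. -/
def lam (μ f0 : ℝ) (n : ℕ) : ℝ :=
  if n = 1 then -μ - (f0/3) * (4*Real.sqrt 2 - 1)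
  else if n = 2 then -4*μ + 2*f0/3
  else -(n:ℝ)^2*μ + 2*f0*((4*(n:ℝ)*Real.sin ((n:ℝ)*π/4) - 8)/((n:ℝ)^2 - 4)
    + ((n:ℝ)*Real.sin ((n:ℝ)*π/2) + (-1:ℝ)^n)/((n:ℝ)^2 - 1) + (-1:ℝ)^n - 2)

/-- Half-interval trigonometric integral. -/
def JJ (k ν a : ℝ) : ℝ := ∫ s in (0:ℝ)..a, Real.sin (k*s) * Real.cos (ν*s)

lemma JJ_neg (k ν a : ℝ) : JJ k (-ν) a = JJ k ν a := by
  unfold JJ; congr 1; ext s; rw [neg_mul, Real.cos_neg]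

lemma JJ_ne (k ν a : ℝ) (h : ν^2 - k^2 ≠ 0) : JJ k ν a =
    (ν * Real.sin (k*a) * Real.sin (ν*a) + k * Real.cos (k*a) * Real.cos (ν*a) - k)/(ν^2-k^2) := by
  unfold JJ
  rw [intervalIntegral.integral_eq_sub_of_hasDerivAt
    (f := fun s => (ν * Real.sin (k*s) * Real.sin (ν*s) + k * Real.cos (k*s) * Real.cos (ν*s))/(ν^2-k^2))]
  · simp; ring
  · intro s _
    have hk : HasDerivAt (fun s : ℝ => k*s) k s := by simpa using (hasDerivAt_id s).const_mul k
    have hν : HasDerivAt (fun s : ℝ => ν*s) ν s := by simpa using (hasDerivAt_id s).const_mul ν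
    have := ((((hk.sin.const_mul ν).mul hν.sin)).add ((hk.cos.const_mul k).mul hν.cos)).div_const (ν^2-k^2)
    refine this.congr_deriv ?_
    field_simp
    ring
  · apply Continuous.intervalIntegrable; fun_prop

lemma JJ_self (k a : ℝ) (h : k ≠ 0) : JJ k k a = Real.sin (k*a)^2/(2*k) := by
  unfold JJ
  rw [intervalIntegral.integral_eq_sub_of_hasDerivAt (f := fun s => Real.sin (k*s)^2/(2*k))]
  · simp
  · intro s _
    have hk : HasDerivAt (fun s : ℝ => k*s) k s := by simpa using (hasDerivAt_id s).const_mul k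
    refine ((hk.sin.pow 2).div_const (2*k)).congr_deriv ?_
    field_simp
    simp
    ring
  · apply Continuous.intervalIntegrable; fun_prop

lemma sym_int (k ν a θ : ℝ) (ha : 0 ≤ a) (hk : 0 ≤ k) (hka : k*a ≤ π) :
    ∫ s in (-a)..a, |Real.sin (k*s)| * Real.cos (θ + ν*s) = 2 * Real.cos θ * JJ k ν a := by
  have hi : ∀ x y : ℝ, IntervalIntegrable (fun s => |Real.sin (k*s)| * Real.cos (θ + ν*s)) volume x y := by
    intro x y; apply Continuous.intervalIntegrable; fun_prop
  have hi2 : IntervalIntegrable (fun s => |Real.sin (k*(-s))| * Real.cos (θ + ν*(-s))) volume 0 a := by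
    apply Continuous.intervalIntegrable; fun_prop
  rw [← intervalIntegral.integral_add_adjacent_intervals (hi (-a) 0) (hi 0 a)]
  have h1 := intervalIntegral.integral_comp_neg (a := 0) (b := a)
    (fun s => |Real.sin (k*s)| * Real.cos (θ + ν*s))
  rw [neg_zero] at h1
  rw [← h1, ← intervalIntegral.integral_add hi2 (hi 0 a)]
  unfold JJ
  rw [← intervalIntegral.integral_const_mul]
  apply intervalIntegral.integral_congr
  intro s hs
  rw [Set.uIcc_of_le ha] at hs
  have h0 : 0 ≤ Real.sin (k*s) := Real.sin_nonneg_of_nonneg_of_le_pi (mul_nonneg hk hs.1)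
    ((mul_le_mul_of_nonneg_left hs.2 hk).trans hka)
  simp only [mul_neg, Real.sin_neg, abs_neg, abs_of_nonneg h0, Real.cos_add, Real.cos_neg]
  ring

lemma shift_int (F : ℝ → ℝ) (c a x y : ℝ) (hx : x = c + -a) (hy : y = c + a) :
    ∫ ψ in x..y, F ψ = ∫ s in (-a)..a, F (c + s) := by
  rw [intervalIntegral.integral_comp_add_left, hx, hy]

lemma gainA (f0 ν c φ : ℝ) :
    (∫ ψ in (φ - π/4)..(φ + π/4), bsin (2*φ - ψ) ψ * f0 * Real.cos (ν*ψ + c))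
      = f0 * (2 * Real.cos (ν*φ+c) * JJ 2 ν (π/4)) := by
  rw [shift_int _ φ (π/4) _ _ (by ring) rfl,
    ← sym_int 2 ν (π/4) (ν*φ+c) (by positivity) (by norm_num) (by linarith [pi_pos]),
    ← intervalIntegral.integral_const_mul]
  congr 1; ext s
  have : |Real.sin (2*φ - (φ+s) - (φ+s))| = |Real.sin (2*s)| := by
    rw [← abs_neg, ← Real.sin_neg]; ring_nf
  unfold bsin
  rw [this, show ν*(φ+s)+c = ν*φ+c+ν*s by ring]; ring

lemma gainB (f0 ν c φ : ℝ) :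
    (∫ ψ in (φ - π/4)..(φ + π/4), bsin (2*φ - ψ) ψ * Real.cos (ν*(2*φ-ψ) + c) * f0)
      = f0 * (2 * Real.cos (ν*φ+c) * JJ 2 ν (π/4)) := by
  rw [shift_int _ φ (π/4) _ _ (by ring) rfl, ← JJ_neg,
    ← sym_int 2 (-ν) (π/4) (ν*φ+c) (by positivity) (by norm_num) (by linarith [pi_pos]),
    ← intervalIntegral.integral_const_mul]
  congr 1; ext s
  have : |Real.sin (2*φ - (φ+s) - (φ+s))| = |Real.sin (2*s)| := by
    rw [← abs_neg, ← Real.sin_neg]; ring_nf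
  unfold bsin
  rw [this, show ν*(2*φ-(φ+s))+c = ν*φ+c+(-ν)*s by ring]; ring

lemma abs_sin_shift (φ s : ℝ) : |Real.sin (φ + π - (φ + π + s + π))| = |Real.sin (1*s)| := by
  rw [show φ + π - (φ + π + s + π) = -(s+π) by ring, Real.sin_neg, Real.sin_add_pi, neg_neg, one_mul]

lemma revA (f0 c φ : ℝ) (n : ℕ) :
    (∫ ψ in (φ + π/2)..(φ + 3*π/2), bsin (φ+π) (ψ+π) * f0 * Real.cos (n*(ψ+π) + c))
      = f0 * (2 * Real.cos (n*φ+c) * JJ 1 n (π/2)) := by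
  rw [shift_int _ (φ+π) (π/2) _ _ (by ring) (by ring),
    ← sym_int 1 n (π/2) (n*φ+c) (by positivity) (by norm_num) (by linarith [pi_pos]),
    ← intervalIntegral.integral_const_mul]
  congr 1; ext s
  unfold bsin
  rw [abs_sin_shift, show (n:ℝ)*(φ+π+s+π)+c = n*φ+c+n*s + n*(2*π) by ring,
    Real.cos_add_nat_mul_two_pi]; ring

lemma JJ10 (a : ℝ) : JJ 1 0 a = 1 - Real.cos a := by
  rw [JJ_ne _ _ _ (by norm_num)]; simp; ring

lemma revB (f0 c φ : ℝ) (n : ℕ) :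
    (∫ ψ in (φ + π/2)..(φ + 3*π/2), bsin (φ+π) (ψ+π) * Real.cos (n*(φ+π) + c) * f0)
      = f0 * (2 * ((-1)^n * Real.cos (n*φ+c))) := by
  have h := sym_int 1 0 (π/2) 0 (by positivity) (by norm_num) (by linarith [pi_pos])
  rw [JJ10, Real.cos_pi_div_two, Real.cos_zero] at h
  rw [shift_int _ (φ+π) (π/2) _ _ (by ring) (by ring)]
  rw [show f0 * (2 * ((-1)^n * Real.cos (n*φ+c))) = f0 * ((-1)^n * Real.cos (n*φ+c)) * (2*1*(1-0)) by ring,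
    ← h, ← intervalIntegral.integral_const_mul]
  congr 1; ext s
  unfold bsin
  rw [abs_sin_shift, show (n:ℝ)*(φ+π)+c = n*φ+c + n*π by ring, Real.cos_add_nat_mul_pi]
  simp; ring

lemma abs_sin_sub (φ s : ℝ) : |Real.sin (φ - (φ + s))| = |Real.sin (1*s)| := by
  rw [show φ - (φ + s) = -s by ring, Real.sin_neg, abs_neg, one_mul]

lemma per_int (F : ℝ → ℝ) (hF : Function.Periodic F (2*π)) (φ : ℝ) :
    ∫ ψ in (0:ℝ)..(2*π), F ψ = ∫ s in (-π)..π, F (φ + s) := by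
  have := hF.intervalIntegral_add_eq 0 (φ + -π)
  rw [zero_add] at this
  rw [this]
  exact shift_int _ _ _ _ _ rfl (by ring)

lemma lossA (f0 c φ : ℝ) (n : ℕ) :
    (∫ ψ in (0:ℝ)..(2*π), bsin φ ψ * f0 * Real.cos (n*ψ + c))
      = f0 * (2 * Real.cos (n*φ+c) * JJ 1 n π) := by
  rw [per_int _ _ φ, ← sym_int 1 n π (n*φ+c) pi_pos.le (by norm_num) (by simp),
    ← intervalIntegral.integral_const_mul]
  · congr 1; ext s
    unfold bsin
    rw [abs_sin_sub, show (n:ℝ)*(φ+s)+c = n*φ+c+n*s by ring]; ring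
  · intro ψ
    simp only [bsin]
    rw [← sub_sub, Real.sin_sub_two_pi, show (n:ℝ)*(ψ+2*π)+c = n*ψ+c + n*(2*π) by ring,
      Real.cos_add_nat_mul_two_pi]

lemma lossB (f0 C φ : ℝ) :
    (∫ ψ in (0:ℝ)..(2*π), bsin φ ψ * C * f0) = f0 * (4 * C) := by
  have h := sym_int 1 0 π 0 pi_pos.le (by norm_num) (by simp)
  rw [JJ10, Real.cos_pi, Real.cos_zero] at h
  rw [per_int _ _ φ, show f0 * (4*C) = f0 * C * (2*1*(1- -1)) by ring, ← h,
    ← intervalIntegral.integral_const_mul]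
  · congr 1; ext s
    unfold bsin
    rw [abs_sin_sub]; simp; ring
  · intro ψ
    simp only [bsin]
    rw [← sub_sub, Real.sin_sub_two_pi]

lemma deriv2 (ν c φ : ℝ) :
    deriv (deriv (fun ψ => Real.cos (ν*ψ + c))) φ = -ν^2 * Real.cos (ν*φ+c) := by
  have hl : ∀ s : ℝ, HasDerivAt (fun s : ℝ => ν*s+c) ν s := fun s => by
    simpa using ((hasDerivAt_id s).const_mul ν).add_const c
  have h1 : deriv (fun ψ => Real.cos (ν*ψ + c)) = fun ψ => -Real.sin (ν*ψ+c) * ν := by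
    ext s; exact (hl s).cos.deriv
  rw [h1]
  have h2 : HasDerivAt (fun ψ => -Real.sin (ν*ψ+c) * ν) (-(Real.cos (ν*φ+c) * ν) * ν) φ :=
    (hl φ).sin.neg.mul_const ν
  rw [h2.deriv]; ring

lemma lam_eq (μ f0 : ℝ) (n : ℕ) (hn : 1 ≤ n) :
    lam μ f0 n = -(n:ℝ)^2*μ + f0 * (8 * JJ 2 n (π/4) + 2 * JJ 1 n (π/2) + 2 * (-1)^n
      - 2 * JJ 1 n π - 4) := by
  have e1 : (2:ℝ)*(π/4) = π/2 := by ring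
  by_cases h1 : n = 1
  · subst h1
    have a := JJ_self 1 (π/2) one_ne_zero
    have b := JJ_self 1 π one_ne_zero
    have d := JJ_ne 2 1 (π/4) (by norm_num)
    rw [e1] at d
    simp only [one_mul, Real.sin_pi_div_two, Real.cos_pi_div_two, Real.sin_pi, Real.sin_pi_div_four] at a b d
    simp only [lam, Nat.cast_one, a, b, d, if_true]
    ring
  by_cases h2 : n = 2
  · subst h2
    have a := JJ_ne 1 2 (π/2) (by norm_num)
    have b := JJ_ne 1 2 π (by norm_num)
    have d := JJ_self 2 (π/4) (by norm_num)
    rw [e1] at d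
    rw [show (2:ℝ)*(π/2) = π by ring] at a
    simp only [one_mul, Real.sin_pi_div_two, Real.cos_pi_div_two, Real.sin_pi, Real.cos_pi, Real.cos_two_pi] at a b d
    simp only [lam, Nat.cast_ofNat, a, b, d]
    norm_num
    ring
  have h3 : (3:ℝ) ≤ n := by exact_mod_cast (show 3 ≤ n by omega)
  have n1 : (n:ℝ)^2 - 1 ≠ 0 := by nlinarith
  have n2 : (n:ℝ)^2 - 4 ≠ 0 := by nlinarith
  have a := JJ_ne 1 n (π/2) (by simpa using n1)
  have b := JJ_ne 1 n π (by simpa using n1)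
  have d := JJ_ne 2 n (π/4) (by norm_num; exact n2)
  rw [e1] at d
  simp only [one_mul, Real.sin_pi_div_two, Real.cos_pi_div_two, Real.sin_pi, Real.cos_pi, Real.cos_nat_mul_pi, one_pow] at a b d
  rw [show (2:ℝ)^2 = 4 by norm_num] at d
  simp only [lam, if_neg h1, if_neg h2, a, b, d, mul_div_assoc]
  field_simp
  ring

lemma diag_general (M μ c φ : ℝ) (n : ℕ) (hn : 1 ≤ n) :
    μ * deriv (deriv (fun ψ => Real.cos ((n:ℝ) * ψ + c))) φ
        + QM1 bsin M (fun ψ => Real.cos ((n:ℝ) * ψ + c)) φ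
      = lam μ (M/(2*π)) n * Real.cos ((n:ℝ) * φ + c) := by
  simp only [QM1, Q1]
  rw [deriv2, gainA, gainB, revA, revB, lossA, lossB, lam_eq _ _ _ hn]
  ring

/-- For the kernel b(φ,φ*) = |sin(φ-φ*)|, the operator μ∂φ² + Q_M is
diagonalized by the trigonometric system, with eigenvalues λ_n. -/
theorem trigonometric_diagonalization
    (M μ : ℝ) (hM : 0 < M) (hμ : 0 < μ) (n : ℕ) (hn : 1 ≤ n) :
    (∀ φ : ℝ,
      μ * deriv (deriv (fun ψ => Real.cos ((n:ℝ) * ψ))) φ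
        + QM1 bsin M (fun ψ => Real.cos ((n:ℝ) * ψ)) φ
      = lam μ (M/(2*π)) n * Real.cos ((n:ℝ) * φ)) ∧
    (∀ φ : ℝ,
      μ * deriv (deriv (fun ψ => Real.sin ((n:ℝ) * ψ))) φ
        + QM1 bsin M (fun ψ => Real.sin ((n:ℝ) * ψ)) φ
      = lam μ (M/(2*π)) n * Real.sin ((n:ℝ) * φ)) := by
  refine ⟨fun φ => ?_, fun φ => ?_⟩
  · simpa using diag_general M μ 0 φ n hn
  · have h := diag_general M μ (-(π/2)) φ n hn
    simpa only [← sub_eq_add_neg, Real.cos_sub_pi_div_two] using h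
end
end

section
/- Let b(φ,φ*) = |sin(φ−φ*)|, f_0 > 0 and μ > 0, and let λ_n (n ≥ 1) denote the eigenvalues of μ ∂_φ² + Q_M on the trigonometric system, namely λ_1 = −μ − (f_0/3)(4√2 − 1), λ_2 = −4μ + 2f_0/3, and λ_n = −n²μ + 2f_0( (4n sin(nπ/4) − 8)/(n²−4) + (n sin(nπ/2) + (−1)ⁿ)/(n²−1) + (−1)ⁿ − 2 ) for n > 2. Then λ_n < 0 for every n ≠ 2 and every μ > 0, while λ_2 ≤ 0 if and only if μ ≥ μ* := f_0/6. In particular all eigenvalues are nonpositive (spectral stability of the uniform equilibrium) exactly when μ ≥ f_0/6, and λ_2 > 0 (spectral instability) when μ < f_0/6. -/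
open MeasureTheory Real Filter

noncomputable section

/-- Spectral stability/instability of the uniform equilibrium: all eigenvalues
λ_n with n ≠ 2 are negative for every μ > 0, while λ_2 ≤ 0 iff μ ≥ μ* = f₀/6. -/
theorem eigenvalue_signs (f0 μ : ℝ) (hf0 : 0 < f0) (hμ : 0 < μ) :
    (∀ n : ℕ, 1 ≤ n → n ≠ 2 → lam μ f0 n < 0) ∧
    (lam μ f0 2 ≤ 0 ↔ f0/6 ≤ μ) ∧
    (μ < f0/6 → 0 < lam μ f0 2) := by
  have key : ∀ n : ℕ, 3 ≤ n → (4*(n:ℝ)*Real.sin ((n:ℝ)*π/4) - 8)/((n:ℝ)^2 - 4)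
    + ((n:ℝ)*Real.sin ((n:ℝ)*π/2) + (-1:ℝ)^n)/((n:ℝ)^2 - 1) + (-1:ℝ)^n - 2 < 0 := by
    intro n hn
    have hx : (3:ℝ) ≤ n := by exact_mod_cast hn
    have h4 : (0:ℝ) < (n:ℝ)^2 - 4 := by nlinarith
    have h1 : (0:ℝ) < (n:ℝ)^2 - 1 := by nlinarith
    have hA : (4*(n:ℝ)*Real.sin ((n:ℝ)*π/4) - 8)/((n:ℝ)^2 - 4) ≤ 4/((n:ℝ)+2) := by
      rw [div_le_div_iff₀ h4 (by linarith)]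
      have hs := Real.sin_le_one ((n:ℝ)*π/4)
      have h5 : 4*(n:ℝ)*Real.sin ((n:ℝ)*π/4) - 8 ≤ 4*n - 8 := by nlinarith
      have h6 := mul_le_mul_of_nonneg_right h5 (show (0:ℝ) ≤ n + 2 by linarith)
      nlinarith
    rcases Nat.even_or_odd n with he | ho
    · have hn4 : 4 ≤ n := by
        rcases he with ⟨k, rfl⟩
        omega
      have hy : (4:ℝ) ≤ n := by exact_mod_cast hn4
      have hs0 : Real.sin ((n:ℝ)*π/2) = 0 := by
        obtain ⟨k, rfl⟩ := he
        rw [← Real.sin_nat_mul_pi k]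
        congr 1
        push_cast
        ring
      rw [he.neg_one_pow, hs0]
      have hB : ((n:ℝ)*0 + 1)/((n:ℝ)^2 - 1) ≤ 1/15 := by
        rw [div_le_div_iff₀ h1 (by norm_num)]
        nlinarith
      have hC : 4/((n:ℝ)+2) ≤ 2/3 := by
        rw [div_le_div_iff₀ (by linarith) (by norm_num)]
        linarith
      linarith
    · rw [ho.neg_one_pow]
      have hB : ((n:ℝ)*Real.sin ((n:ℝ)*π/2) + (-1))/((n:ℝ)^2 - 1) ≤ 1 := by
        rw [div_le_one h1]
        have hs := Real.sin_le_one ((n:ℝ)*π/2)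
        nlinarith
      have hC : 4/((n:ℝ)+2) ≤ 4/5 := by
        rw [div_le_div_iff₀ (by linarith) (by norm_num)]
        linarith
      linarith
  have h2 : lam μ f0 2 = -4*μ + 2*f0/3 := by simp [lam]
  refine ⟨?_, ?_, ?_⟩
  · intro n hn hn2
    unfold lam
    by_cases h : n = 1
    · rw [if_pos h]
      have hq : (1:ℝ) ≤ Real.sqrt 2 := by
        rw [Real.one_le_sqrt]
        norm_num
      have : 0 < (f0/3) * (4*Real.sqrt 2 - 1) := mul_pos (by linarith) (by linarith)
      linarith
    · rw [if_neg h, if_neg hn2]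
      have hk := key n (by omega)
      have h3 := mul_neg_of_pos_of_neg (show 0 < 2*f0 by linarith) hk
      have h4 : 0 ≤ (n:ℝ)^2*μ := by positivity
      linarith
  · rw [h2]
    constructor <;> intro h <;> linarith
  · intro h
    rw [h2]
    linarith
end
end

section
/- Let b(φ,φ*) = |sin(φ−φ*)|, M > 0, f_0 = M/(2π), and μ* = f_0/6. If f ∈ H²(𝕋¹) satisfies μ* f'' + Q_M f = 0, together with the constraints ∫_{𝕋¹} f dφ = 0 and f(0) = 0, then f(φ) = c sin(2φ) for some constant c ∈ ℝ; that is, the null space of μ* ∂_φ² + Q_M subject to these two constraints is one-dimensional and spanned by sin(2φ). -/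
open MeasureTheory Real Filter

noncomputable section

lemma abs_sin_int (a : ℝ) : ∫ u in a..(a+π), |Real.sin u| = 2 := by
  have hp : Function.Periodic (fun u => |Real.sin u|) π := by
    intro u; simp [Real.sin_add_pi]
  rw [hp.intervalIntegral_add_eq a 0, zero_add]
  have : ∫ u in (0:ℝ)..π, |Real.sin u| = ∫ u in (0:ℝ)..π, Real.sin u := by
    apply intervalIntegral.integral_congr
    intro u hu
    rw [Set.uIcc_of_le pi_pos.le] at hu
    exact abs_of_nonneg (Real.sin_nonneg_of_mem_Icc hu)
  rw [this, integral_sin]; norm_num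

lemma abs_sin_int1 : ∫ u in (π/2)..(3*π/2), |Real.sin u| = 2 := by
  have h := abs_sin_int (π/2)
  rwa [show π/2 + π = 3*π/2 by ring] at h

lemma abs_sin_int2 : ∫ u in (-(π/4))..(π/4), |Real.sin (2*u)| = 1 := by
  rw [intervalIntegral.integral_comp_mul_left (fun u => |Real.sin u|) two_ne_zero]
  have : (2:ℝ) * (π/4) = 2 * (-(π/4)) + π := by ring
  rw [this, abs_sin_int]; norm_num

lemma QM_formula (M : ℝ) (f : ℝ → ℝ) (hper : Function.Periodic f (2*π)) (hc : Continuous f)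
    (φ : ℝ) : QM1 bsin M f φ = M/(2*π) * (4 * (∫ u in (-(π/4))..(π/4), |Real.sin (2*u)| * f (φ+u))
      - (∫ u in (π/2)..(3*π/2), |Real.sin u| * f (φ+u)) + 2 * f (φ+π) - 4 * f φ) := by
  unfold QM1 Q1 bsin
  set c := M/(2*π) with hcdef
  have e1 : (∫ ψ in (φ - π/4)..(φ + π/4), |Real.sin (2*φ - ψ - ψ)| * c * f ψ)
      = c * ∫ u in (-(π/4))..(π/4), |Real.sin (2*u)| * f (φ+u) := by
    rw [sub_eq_add_neg, ← intervalIntegral.integral_comp_add_left, ← intervalIntegral.integral_const_mul]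
    congr 1; ext u
    rw [show 2*φ - (φ+u) - (φ+u) = -(2*u) by ring, Real.sin_neg, abs_neg]; ring
  have e2 : (∫ ψ in (φ - π/4)..(φ + π/4), |Real.sin (2*φ - ψ - ψ)| * f (2*φ-ψ) * c)
      = c * ∫ u in (-(π/4))..(π/4), |Real.sin (2*u)| * f (φ+u) := by
    rw [show φ + π/4 = φ - (-(π/4)) by ring, ← intervalIntegral.integral_comp_sub_left, ← intervalIntegral.integral_const_mul]
    congr 1; ext u
    rw [show 2*φ - (φ-u) - (φ-u) = (2*u) by ring, show 2*φ - (φ-u) = φ + u by ring]; ring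
  have e3 : (∫ ψ in (φ + π/2)..(φ + 3*π/2), |Real.sin (φ + π - (ψ + π))| * c * f (ψ+π))
      = c * ∫ u in (3*π/2)..(5*π/2), |Real.sin u| * f (φ+u) := by
    rw [← intervalIntegral.integral_comp_add_left, show 3*π/2 = π/2+π by ring,
      show 5*π/2 = (π/2+π)+π by ring,
      ← intervalIntegral.integral_comp_add_right (fun u => |Real.sin u| * f (φ+u)), ← intervalIntegral.integral_const_mul]
    congr 1; ext u
    rw [show φ + π - (φ + u + π) = -u by ring, Real.sin_neg, Real.sin_add_pi, abs_neg,
      add_assoc]; ring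
  have e4 : (∫ ψ in (φ + π/2)..(φ + 3*π/2), |Real.sin (φ + π - (ψ + π))| * f (φ+π) * c)
      = c * (2 * f (φ+π)) := by
    have h2 : c * (2 * f (φ+π)) = ∫ u in (π/2)..(3*π/2), |Real.sin u| * (c * f (φ+π)) := by
      rw [intervalIntegral.integral_mul_const, abs_sin_int1]; ring
    rw [h2, ← intervalIntegral.integral_comp_add_left]
    congr 1; ext u
    rw [show φ + π - (φ + u + π) = -u by ring, Real.sin_neg, abs_neg]; ring
  have key : ∀ g : ℝ → ℝ, Function.Periodic g (2*π) → Continuous g →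
      (∫ ψ in (0:ℝ)..(2*π), |Real.sin (φ - ψ)| * g ψ) =
       (∫ u in (π/2)..(3*π/2), |Real.sin u| * g (φ+u)) +
       ∫ u in (3*π/2)..(5*π/2), |Real.sin u| * g (φ+u) := by
    intro g hg hgc
    have hp : Function.Periodic (fun ψ => |Real.sin (φ - ψ)| * g ψ) (2*π) := by
      intro ψ
      simp only
      rw [hg, show φ - (ψ + 2*π) = φ - ψ - 2*π by ring, Real.sin_sub_two_pi]
    have h0 := hp.intervalIntegral_add_eq 0 (φ + π/2)
    rw [zero_add] at h0
    rw [h0, intervalIntegral.integral_add_adjacent_intervals,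
      show φ + π/2 + 2*π = φ + 5*π/2 by ring, ← intervalIntegral.integral_comp_add_left]
    · congr 1; ext u
      rw [show φ - (φ + u) = -u by ring, Real.sin_neg, abs_neg]
    · apply Continuous.intervalIntegrable; fun_prop
    · apply Continuous.intervalIntegrable; fun_prop
  have e5 : (∫ ψ in (0:ℝ)..(2*π), |Real.sin (φ - ψ)| * c * f ψ) =
      c * ((∫ u in (π/2)..(3*π/2), |Real.sin u| * f (φ+u)) +
       ∫ u in (3*π/2)..(5*π/2), |Real.sin u| * f (φ+u)) := by
    rw [← key f hper hc, ← intervalIntegral.integral_const_mul]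
    congr 1; ext u; ring
  have e6 : (∫ ψ in (0:ℝ)..(2*π), |Real.sin (φ - ψ)| * f φ * c) = c * (4 * f φ) := by
    have h := key (fun _ => f φ * c) (fun _ => rfl) continuous_const
    simp only [mul_assoc] at h ⊢
    rw [h]
    rw [intervalIntegral.integral_mul_const, intervalIntegral.integral_mul_const, abs_sin_int1,
      show 5*π/2 = 3*π/2 + π by ring, abs_sin_int]
    ring
  rw [e1, e2, e3, e4, e5, e6]; ring

/-- unnormalised Fourier coefficients -/
def LF (n : ℤ) (g : ℝ → ℝ) : ℂ :=
  ∫ x in (0:ℝ)..(2*π), (g x : ℂ) * Complex.exp (-(n * x * Complex.I))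

lemma exp_per (n : ℤ) (x : ℝ) : Complex.exp (-(n * ((x + 2*π : ℝ):ℂ) * Complex.I))
    = Complex.exp (-(n * x * Complex.I)) := by
  rw [← Complex.exp_periodic.int_mul (-n) (-(n * x * Complex.I))]
  congr 1; push_cast; ring

lemma LF_shift (n : ℤ) (g : ℝ → ℝ) (hg : Function.Periodic g (2*π)) (u : ℝ) :
    LF n (fun x => g (x+u)) = Complex.exp (n * u * Complex.I) * LF n g := by
  unfold LF
  have hp : Function.Periodic (fun x : ℝ => (g x : ℂ) * Complex.exp (-(n * x * Complex.I))) (2*π) := by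
    intro x
    simp only
    rw [exp_per, hg]
  have h0 := hp.intervalIntegral_add_eq 0 u
  rw [zero_add] at h0
  rw [h0, add_comm u, ← zero_add u, ← add_assoc, add_zero (2*π),
    ← intervalIntegral.integral_comp_add_right, ← intervalIntegral.integral_const_mul]
  congr 1; ext x
  rw [zero_add, mul_left_comm, ← Complex.exp_add]
  congr 2; push_cast; ring

lemma LF_deriv (n : ℤ) (g : ℝ → ℝ) (hg : Function.Periodic g (2*π)) (hd : ContDiff ℝ 1 g) :
    LF n (deriv g) = n * Complex.I * LF n g := by
  unfold LF
  have hd' : Continuous (deriv g) := hd.continuous_deriv le_rfl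
  have hv : ∀ x : ℝ, HasDerivAt (fun x : ℝ => Complex.exp (-(n * x * Complex.I)))
      (Complex.exp (-(n * x * Complex.I)) * (-(n * 1 * Complex.I))) x := by
    intro x
    have h1 : HasDerivAt (fun x : ℝ => (x:ℂ)) 1 x := Complex.ofRealCLM.hasDerivAt
    exact (((h1.const_mul (n:ℂ)).mul_const Complex.I).neg).cexp
  have hu : ∀ x : ℝ, HasDerivAt (fun x : ℝ => (g x:ℂ)) ((deriv g x : ℝ):ℂ) x := by
    intro x
    exact ((hd.differentiable one_ne_zero) x).hasDerivAt.ofReal_comp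
  have h := intervalIntegral.integral_mul_deriv_eq_deriv_mul (a := 0) (b := 2*π)
    (fun x _ => hu x) (fun x _ => hv x)
    (by apply Continuous.intervalIntegrable; fun_prop)
    (by apply Continuous.intervalIntegrable; fun_prop)
  have hb := exp_per n 0
  have hb2 := hg 0
  rw [zero_add] at hb hb2
  rw [hb, hb2, sub_self, zero_sub] at h
  rw [← neg_eq_iff_eq_neg.mpr h, ← intervalIntegral.integral_const_mul,
    ← intervalIntegral.integral_neg]
  congr 1; ext x; ring

lemma LF_conv (n : ℤ) (g k : ℝ → ℝ) (hg : Function.Periodic g (2*π)) (hc : Continuous g)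
    (hk : Continuous k) (a b : ℝ) :
    LF n (fun x => ∫ u in a..b, k u * g (x+u)) =
      (∫ u in a..b, (k u : ℂ) * Complex.exp (n * u * Complex.I)) * LF n g := by
  rw [← intervalIntegral.integral_mul_const]
  have h1 : ∀ u : ℝ, (k u : ℂ) * Complex.exp (n * u * Complex.I) * LF n g =
      ∫ x in (0:ℝ)..(2*π), (k u : ℂ) * ((g (x+u) : ℂ) * Complex.exp (-(n * x * Complex.I))) := by
    intro u
    rw [mul_assoc, ← LF_shift n g hg, LF, intervalIntegral.integral_const_mul]
  have h2 : ∀ x : ℝ, ((∫ u in a..b, k u * g (x+u) : ℝ) : ℂ) * Complex.exp (-(n * x * Complex.I)) =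
      ∫ u in a..b, (k u : ℂ) * ((g (x+u) : ℂ) * Complex.exp (-(n * x * Complex.I))) := by
    intro x
    rw [← intervalIntegral.integral_ofReal, ← intervalIntegral.integral_mul_const]
    congr 1; ext u; push_cast; ring
  simp_rw [h1]
  unfold LF
  simp_rw [h2]
  apply intervalIntegral_intervalIntegral_swap
  have hcont : Continuous (Function.uncurry fun (x u : ℝ) =>
      (k u : ℂ) * ((g (x+u) : ℂ) * Complex.exp (-(n * x * Complex.I)))) := by
    unfold Function.uncurry
    fun_prop
  exact (hcont.continuousOn.integrableOn_compact
    (isCompact_uIcc.prod isCompact_uIcc)).mono_set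
      (Set.prod_mono Set.uIoc_subset_uIcc Set.uIoc_subset_uIcc)

lemma LF_add (n : ℤ) (g h : ℝ → ℝ) (hg : Continuous g) (hh : Continuous h) :
    LF n (fun x => g x + h x) = LF n g + LF n h := by
  unfold LF
  rw [← intervalIntegral.integral_add]
  · congr 1; ext x; push_cast; ring
  · apply Continuous.intervalIntegrable; fun_prop
  · apply Continuous.intervalIntegrable; fun_prop

lemma LF_smul (n : ℤ) (c : ℝ) (g : ℝ → ℝ) :
    LF n (fun x => c * g x) = c * LF n g := by
  unfold LF
  rw [← intervalIntegral.integral_const_mul]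
  congr 1; ext x; push_cast; ring

lemma kernel_norm (n : ℤ) (k : ℝ → ℝ) (a b : ℝ) (hab : a ≤ b) :
    ‖∫ u in a..b, ((|k u| : ℝ) : ℂ) * Complex.exp (n * u * Complex.I)‖ ≤ ∫ u in a..b, |k u| := by
  refine (intervalIntegral.norm_integral_le_integral_norm hab).trans_eq ?_
  congr 1; ext u
  have : (n * u * Complex.I : ℂ) = ((n * u : ℝ) : ℂ) * Complex.I := by push_cast; ring
  rw [norm_mul, this, Complex.norm_exp_ofReal_mul_I]
  simp

lemma kernel_four (n : ℤ) (hn : n = 4 ∨ n = -4) :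
    (∫ u in (-(π/4))..(π/4), ((|Real.sin (2*u)| : ℝ) : ℂ) * Complex.exp (n * u * Complex.I))
      = -1/3 := by
  have hcont : Continuous (fun u : ℝ =>
      ((|Real.sin (2*u)| : ℝ) : ℂ) * Complex.exp (n * u * Complex.I)) := by fun_prop
  rw [← intervalIntegral.integral_add_adjacent_intervals (b := 0)
    (hcont.intervalIntegrable _ _) (hcont.intervalIntegrable _ _)]
  have hneg := intervalIntegral.integral_comp_neg (a := 0) (b := π/4) (fun u : ℝ =>
      ((|Real.sin (2*u)| : ℝ) : ℂ) * Complex.exp (n * u * Complex.I))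
  rw [neg_zero] at hneg
  rw [← hneg, ← intervalIntegral.integral_add]
  rotate_left
  · apply Continuous.intervalIntegrable; fun_prop
  · apply Continuous.intervalIntegrable; fun_prop
  have h1 : ∀ u ∈ Set.uIcc 0 (π/4), ((|Real.sin (2*(-u))| : ℝ) : ℂ) * Complex.exp (n * ((-u : ℝ) : ℂ) * Complex.I)
      + ((|Real.sin (2*u)| : ℝ) : ℂ) * Complex.exp (n * u * Complex.I)
      = ((Real.sin (6*u) - Real.sin (2*u) : ℝ) : ℂ) := by
    intro u hu
    rw [Set.uIcc_of_le (by positivity)] at hu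
    have hs : 0 ≤ Real.sin (2*u) := Real.sin_nonneg_of_nonneg_of_le_pi (by linarith [hu.1])
      (by linarith [hu.2, pi_pos])
    rw [mul_neg, Real.sin_neg, abs_neg, abs_of_nonneg hs, ← mul_add]
    have e : Complex.exp (n * ((-u : ℝ) : ℂ) * Complex.I) + Complex.exp (n * u * Complex.I)
        = ((2 * Real.cos (4*u) : ℝ) : ℂ) := by
      have := Complex.two_cos (4*u)
      push_cast
      rw [this]
      rcases hn with rfl | rfl
      · rw [add_comm]; push_cast; congr 2; ring
      · push_cast; congr 2 <;> ring
    rw [e, ← Complex.ofReal_mul]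
    congr 1
    rw [show 6*u = 4*u + 2*u by ring, Real.sin_add]
    have := Real.sin_sub (4*u) (2*u)
    rw [show 4*u - 2*u = 2*u by ring] at this
    linear_combination this
  rw [intervalIntegral.integral_congr h1, intervalIntegral.integral_ofReal,
    intervalIntegral.integral_sub (by apply Continuous.intervalIntegrable; fun_prop)
      (by apply Continuous.intervalIntegrable; fun_prop),
    intervalIntegral.integral_comp_mul_left (fun u => Real.sin u) (by norm_num),
    intervalIntegral.integral_comp_mul_left (fun u => Real.sin u) (by norm_num),
    integral_sin, integral_sin, show 6 * (π/4) = π/2 + π by ring, show 2 * (π/4) = π/2 by ring,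
    Real.cos_add_pi, Real.cos_pi_div_two]
  norm_num

lemma exp_pi_int (n : ℤ) : Complex.exp (n * π * Complex.I) = if Even n then 1 else -1 := by
  rw [mul_assoc, Complex.exp_int_mul, Complex.exp_pi_mul_I]
  split_ifs with h
  · exact h.neg_one_zpow
  · exact (Int.not_even_iff_odd.mp h).neg_one_zpow

lemma mult_ne (n : ℤ) (h0 : n ≠ 0) (h2 : n ≠ 2) (h2' : n ≠ -2) :
    (1/6 : ℂ) * (n * Complex.I * (n * Complex.I)) + (4 * (∫ u in (-(π/4))..(π/4), ((|Real.sin (2*u)| : ℝ) : ℂ) * Complex.exp (n * u * Complex.I))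
      - (∫ u in (π/2)..(3*π/2), ((|Real.sin u| : ℝ) : ℂ) * Complex.exp (n * u * Complex.I))
      + 2 * Complex.exp (n * π * Complex.I) - 4) ≠ 0 := by
  have hA := kernel_norm n (fun u => Real.sin (2*u)) (-(π/4)) (π/4) (by linarith [pi_pos])
  have hB := kernel_norm n Real.sin (π/2) (3*π/2) (by linarith [pi_pos])
  have h4 := kernel_four n
  rw [abs_sin_int1] at hB
  rw [abs_sin_int2] at hA
  rw [exp_pi_int]
  set A := (∫ u in (-(π/4))..(π/4), ((|Real.sin (2*u)| : ℝ) : ℂ) * Complex.exp (n * u * Complex.I))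
  set B := (∫ u in (π/2)..(3*π/2), ((|Real.sin u| : ℝ) : ℂ) * Complex.exp (n * u * Complex.I))
  intro h
  have hA' : A.re ≤ 1 := (Complex.re_le_norm A).trans hA
  have hB' : -2 ≤ B.re := by
    have := (Complex.abs_re_le_norm B).trans hB
    exact (abs_le.mp this).1
  have hsq : (n * Complex.I * (n * Complex.I) : ℂ) = ((-(n:ℝ)^2 : ℝ) : ℂ) := by
    push_cast
    linear_combination (n:ℂ)^2 * Complex.I_sq
  obtain ⟨q, hq⟩ : ∃ q : ℝ, q = (n:ℝ)^2 := ⟨_, rfl⟩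
  rw [hsq, ← hq] at h
  have hre := congrArg Complex.re h
  have h16 : (1/6 : ℂ) = ((1/6 : ℝ) : ℂ) := by push_cast; rfl
  rw [h16, ← Complex.ofReal_mul] at hre
  by_cases he : Even n
  · simp only [if_pos he] at hre
    simp at hre
    by_cases hf : n = 4 ∨ n = -4
    · have hA4 := h4 hf
      have : A.re = -1/3 := by rw [hA4]; simp
      have hq0 : 0 ≤ q := by rw [hq]; positivity
      linarith
    · push Not at hf
      obtain ⟨m, rfl⟩ := he
      have : (25:ℤ) ≤ (m+m)^2 := by
        have : m ≤ -3 ∨ 3 ≤ m := by omega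
        rcases this with h | h <;> nlinarith
      have : (25:ℝ) ≤ ((m+m : ℤ):ℝ)^2 := by exact_mod_cast this
      rw [← hq] at this
      linarith
  · simp only [if_neg he] at hre
    simp at hre
    have : (0:ℝ) < q := by rw [hq]; positivity
    linarith

/-- The null space of μ*∂φ² + Q_M (with μ* = f₀/6 and kernel |sin|), subject to
zero mean and the auxiliary condition f(0) = 0, is spanned by sin(2φ). -/
theorem nullspace_spanned_by_sin2
    (M : ℝ) (hM : 0 < M) (f : ℝ → ℝ)
    (hper : Function.Periodic f (2*π)) (hreg : ContDiff ℝ 2 f)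
    (heq : ∀ φ, (M/(2*π))/6 * deriv (deriv f) φ + QM1 bsin M f φ = 0)
    (hmean : (∫ φ in (0:ℝ)..(2*π), f φ) = 0)
    (haux : f 0 = 0) :
    ∃ c : ℝ, ∀ φ, f φ = c * Real.sin (2*φ) := by
  have hc : Continuous f := hreg.continuous
  have hd1 : ContDiff ℝ 1 (deriv f) := by
    have : ContDiff ℝ (1+1) f := by simpa [one_add_one_eq_two] using hreg
    exact (contDiff_succ_iff_deriv.mp this).2.2
  have hd2 : Continuous (deriv (deriv f)) := hd1.continuous_deriv le_rfl
  have hper1 : Function.Periodic (deriv f) (2*π) := by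
    intro x
    have h : (fun y => f (y + 2*π)) = f := funext hper
    rw [← deriv_comp_add_const, h]
  set m := M/(2*π) with hm
  have hm0 : m ≠ 0 := by positivity
  have hL : ∀ n : ℤ, n ≠ 2 → n ≠ -2 → LF n f = 0 := by
    intro n h2 h2'
    by_cases h0 : n = 0
    · subst h0
      unfold LF
      simp [intervalIntegral.integral_ofReal, hmean]
    have hz : LF n (fun x => (1/6) * deriv (deriv f) x +
        (4 * (∫ u in (-(π/4))..(π/4), |Real.sin (2*u)| * f (x+u))
        + ((-1) * (∫ u in (π/2)..(3*π/2), |Real.sin u| * f (x+u))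
        + (2 * f (x+π) + (-4) * f x)))) = 0 := by
      have : (fun x => (1/6) * deriv (deriv f) x +
        (4 * (∫ u in (-(π/4))..(π/4), |Real.sin (2*u)| * f (x+u))
        + ((-1) * (∫ u in (π/2)..(3*π/2), |Real.sin u| * f (x+u))
        + (2 * f (x+π) + (-4) * f x)))) = fun _ => 0 := by
        funext x
        have h := heq x
        rw [QM_formula M f hper hc] at h
        apply mul_left_cancel₀ hm0
        rw [mul_zero, ← h]
        ring
      rw [this]; simp [LF]
    have c1 : Continuous (fun x => ∫ u in (-(π/4))..(π/4), |Real.sin (2*u)| * f (x+u)) := by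
      apply intervalIntegral.continuous_parametric_intervalIntegral_of_continuous'
      unfold Function.uncurry; fun_prop
    have c2 : Continuous (fun x => ∫ u in (π/2)..(3*π/2), |Real.sin u| * f (x+u)) := by
      apply intervalIntegral.continuous_parametric_intervalIntegral_of_continuous'
      unfold Function.uncurry; fun_prop
    rw [LF_add n _ _ (by fun_prop) (by fun_prop), LF_add n _ _ (by fun_prop) (by fun_prop),
      LF_add n _ _ (by fun_prop) (by fun_prop), LF_add n _ _ (by fun_prop) (by fun_prop),
      LF_smul, LF_smul, LF_smul, LF_smul, LF_smul, LF_shift n f hper,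
      LF_conv n f (fun u => |Real.sin (2*u)|) hper hc (by fun_prop),
      LF_conv n f (fun u => |Real.sin u|) hper hc (by fun_prop),
      LF_deriv n _ hper1 hd1, LF_deriv n f hper (hreg.of_le (by norm_num))] at hz
    refine (mul_eq_zero.mp ?_).resolve_left (mult_ne n h0 h2 h2')
    rw [← hz]; push_cast; ring
  have : Fact (0 < 2*π) := ⟨two_pi_pos⟩
  have hperC : Function.Periodic (fun x => (f x : ℂ)) (2*π) := fun x => by simp only [hper x]
  let F : C(AddCircle (2*π), ℂ) := ⟨hperC.lift, by
    apply continuous_coinduced_dom.mpr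
    exact Complex.continuous_ofReal.comp hc⟩
  have hF : ∀ x : ℝ, F (x : AddCircle (2*π)) = f x := fun x => rfl
  have hfo : ∀ (n : ℤ) (x : ℝ), fourier n (x : AddCircle (2*π)) = Complex.exp (n * x * Complex.I) := by
    intro n x
    rw [fourier_coe_apply]
    congr 1
    have : (π:ℂ) ≠ 0 := by exact_mod_cast pi_ne_zero
    push_cast
    field_simp
  have hco : ∀ n : ℤ, fourierCoeff F n = ((1/(2*π) : ℝ) : ℂ) * LF n f := by
    intro n
    rw [fourierCoeff_eq_intervalIntegral F n 0, zero_add, LF, Complex.real_smul]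
    congr 2; ext x
    rw [hfo, hF, smul_eq_mul, mul_comm]
    push_cast
    congr 2; ring
  have hco0 : ∀ n ∉ ({2, -2} : Finset ℤ), fourierCoeff F n = 0 := by
    intro n hn
    simp only [Finset.mem_insert, Finset.mem_singleton, not_or] at hn
    rw [hco, hL n hn.1 hn.2, mul_zero]
  have hsum : Summable (fourierCoeff F) := summable_of_ne_finset_zero hco0
  have hrep : ∀ x : ℝ, (f x : ℂ) = fourierCoeff F 2 * Complex.exp (2 * x * Complex.I)
      + fourierCoeff F (-2) * Complex.exp (-(2 * x) * Complex.I) := by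
    intro x
    have h1 := has_pointwise_sum_fourier_series_of_summable hsum (x : AddCircle (2*π))
    have h2 := hasSum_sum_of_ne_finset_zero (L := SummationFilter.unconditional ℤ) (s := ({2, -2} : Finset ℤ))
      (f := fun i => fourierCoeff F i • fourier i (x : AddCircle (2*π)))
      (fun n hn => by rw [hco0 n hn, zero_smul])
    have h3 := h1.unique h2
    rw [hF, Finset.sum_pair (by norm_num), hfo, hfo] at h3
    rw [h3]
    simp
  have hz := hrep 0
  simp [haux] at hz
  refine ⟨(2 * Complex.I * fourierCoeff F 2).re, fun x => ?_⟩
  have h := hrep x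
  have hneg : fourierCoeff F (-2) = - fourierCoeff F 2 := by linear_combination -hz
  rw [hneg] at h
  have hs := Complex.two_sin (2*x)
  have : (f x : ℂ) = (2 * Complex.I * fourierCoeff F 2) * ((Real.sin (2*x) : ℝ) : ℂ) := by
    push_cast
    rw [h]
    linear_combination -(Complex.I * fourierCoeff F 2) * hs - fourierCoeff F 2 * (Complex.exp (-(2*x) * Complex.I) - Complex.exp (2*x*Complex.I)) * Complex.I_sq
  have h' := congrArg Complex.re this
  rwa [Complex.re_mul_ofReal, Complex.ofReal_re] at h'
end
end

section
/- The map S sends B into itself: for every F ∈ B, the function S(F) is nonnegative, even, bounded and continuous, satisfies ∫_ℝ S(F)(ξ) dξ = 1 and ∫_ℝ ξ² S(F)(ξ) dξ = 4, and moreover obeys the uniform bound S(F)(ξ) ≤ 1/2 for all ξ ∈ ℝ. -/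
open MeasureTheory Real Filter

noncomputable section

/-- The fixed-point map S(F)(ξ) = ∫∫ e^{-|ξ-ξ̃|} F(2ξ̃-ξ*) F(ξ*) dξ* dξ̃. -/
def S (F : ℝ → ℝ) : ℝ → ℝ := fun ξ =>
  ∫ η : ℝ, ∫ ζ : ℝ, Real.exp (-|ξ - η|) * F (2*η - ζ) * F ζ

/-- The set B of nonnegative, even, bounded continuous integrable functions with
total integral 1 and second moment 4. -/
def memB (F : ℝ → ℝ) : Prop :=
  Continuous F ∧ (∀ ξ, 0 ≤ F ξ) ∧ (∀ ξ, F (-ξ) = F ξ) ∧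
  MeasureTheory.Integrable F ∧ (∃ K : ℝ, ∀ ξ, |F ξ| ≤ K) ∧
  (∫ ξ : ℝ, F ξ) = 1 ∧
  MeasureTheory.Integrable (fun ξ : ℝ => ξ^2 * F ξ) ∧
  (∫ ξ : ℝ, ξ^2 * F ξ) = 4

/-- A quantitative version of membership in `B`. -/
structure PB (f : ℝ → ℝ) (a m : ℝ) : Prop where
  cont : Continuous f
  nonneg : ∀ x, 0 ≤ f x
  even : ∀ x, f (-x) = f x
  int : Integrable f
  bdd : ∃ K : ℝ, ∀ x, |f x| ≤ K
  mass : (∫ x : ℝ, f x) = a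
  int2 : Integrable (fun x : ℝ => x^2 * f x)
  mom : (∫ x : ℝ, x^2 * f x) = m

/-- Convolution on the line. -/
def cv (f g : ℝ → ℝ) : ℝ → ℝ := fun x => ∫ t : ℝ, f (x - t) * g t

theorem cv_eq (f g : ℝ → ℝ) :
    cv f g = convolution g f (ContinuousLinearMap.mul ℝ ℝ) volume := by
  funext x
  simp [cv, convolution, mul_comm]

theorem cv_int {f g : ℝ → ℝ} (hf : Integrable f) (hg : Integrable g) : Integrable (cv f g) := by
  rw [cv_eq]; exact hg.integrable_convolution _ hf

theorem cv_mass {f g : ℝ → ℝ} (hf : Integrable f) (hg : Integrable g) :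
    ∫ x, cv f g x = (∫ x, f x) * ∫ x, g x := by
  rw [cv_eq, integral_convolution _ hg hf]
  simp [mul_comm]

theorem cv_ae {f g : ℝ → ℝ} (hf : Integrable f) (hg : Integrable g) :
    ∀ᵐ x, Integrable (fun t => f (x - t) * g t) := by
  have h := hg.ae_convolution_exists (ContinuousLinearMap.mul ℝ ℝ) hf
  filter_upwards [h] with x hx
  have hx2 : Integrable (fun t => g t * f (x - t)) := hx
  simpa [mul_comm] using hx2

theorem PB.int1 {f : ℝ → ℝ} {a m : ℝ} (h : PB f a m) : Integrable (fun x => x * f x) := by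
  refine (h.int.add h.int2).mono' (continuous_id.mul h.cont).aestronglyMeasurable ?_
  refine ae_of_all _ fun x => ?_
  have h0 := h.nonneg x
  simp only [Pi.add_apply, Real.norm_eq_abs, abs_mul, abs_of_nonneg h0]
  have : |x| ≤ 1 + x^2 := by
    rw [abs_le]; constructor <;> nlinarith [sq_nonneg (x-1), sq_nonneg (x+1)]
  nlinarith

theorem PB.mom1 {f : ℝ → ℝ} {a m : ℝ} (h : PB f a m) : ∫ x, x * f x = 0 := by
  have h1 := integral_neg_eq_self (fun x => x * f x) volume
  have h2 : (fun x : ℝ => (-x) * f (-x)) = fun x => - (x * f x) := by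
    funext x; rw [h.even]; ring
  rw [h2, integral_neg] at h1
  linarith

theorem PB.cv {f g : ℝ → ℝ} {a m b n : ℝ} (hf : PB f a m) (hg : PB g b n) :
    PB (cv f g) (a * b) (m * b + a * n) := by
  obtain ⟨K, hK⟩ := hf.bdd
  have hi : ∀ x, Integrable (fun t => f (x - t) * g t) := fun x =>
    hg.int.bdd_mul (c := K) (by have := hf.cont; fun_prop) (ae_of_all _ fun t => hK _)
  have key : _root_.cv (fun x => x^2 * f x) g + (fun x => 2 * _root_.cv (fun x => x * f x) (fun x => x * g x) x)
      + _root_.cv f (fun x => x^2 * g x) =ᵐ[volume] fun x => x^2 * _root_.cv f g x := by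
    filter_upwards [cv_ae hf.int2 hg.int, cv_ae hf.int1 hg.int1, cv_ae hf.int hg.int2]
      with x h1 h2 h3
    simp only [Pi.add_apply, _root_.cv]
    rw [← integral_const_mul, ← integral_const_mul, ← integral_add h1 (h2.const_mul 2)]
    refine (integral_add (h1.add (h2.const_mul 2)) h3).symm.trans ?_
    congr 1; funext t; simp only [Pi.add_apply]; ring
  have i1 := cv_int hf.int2 hg.int
  have i2 := (cv_int hf.int1 hg.int1).const_mul 2
  have i3 := cv_int hf.int hg.int2
  have hnn : ∀ x, 0 ≤ _root_.cv f g x := fun x =>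
    integral_nonneg fun t => mul_nonneg (hf.nonneg _) (hg.nonneg _)
  refine ⟨?_, hnn, ?_, cv_int hf.int hg.int, ⟨K * b, ?_⟩, ?_, ?_, ?_⟩
  · rw [cv_eq]
    refine BddAbove.continuous_convolution_right_of_integrable _ ?_ hg.int hf.cont
    exact ⟨K, by rintro _ ⟨x, rfl⟩; exact hK x⟩
  · intro x
    have := integral_neg_eq_self (fun t => f (-x - t) * g t) volume
    simp only [_root_.cv]
    rw [← this]
    congr 1; funext t
    rw [hg.even, ← hf.even]; congr 2; ring
  · intro x
    rw [abs_of_nonneg (hnn x), ← hg.mass, ← integral_const_mul]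
    exact integral_mono (hi x) (hg.int.const_mul K) fun t =>
      mul_le_mul_of_nonneg_right ((le_abs_self _).trans (hK _)) (hg.nonneg t)
  · rw [cv_mass hf.int hg.int, hf.mass, hg.mass]
  · exact ((i1.add i2).add i3).congr key
  · rw [← integral_congr_ae key, integral_add' (i1.add i2) i3, integral_add' i1 i2,
      integral_const_mul, cv_mass hf.int2 hg.int, cv_mass hf.int1 hg.int1, cv_mass hf.int hg.int2,
      hf.mom1, hg.mom1, hf.mass, hg.mass, hf.mom, hg.mom]
    ring

theorem PB.scale {f : ℝ → ℝ} {a m : ℝ} (hf : PB f a m) :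
    PB (fun x => f (2 * x)) (a / 2) (m / 8) := by
  obtain ⟨K, hK⟩ := hf.bdd
  have e : (fun x : ℝ => x^2 * f (2*x)) = fun x => (1/4) * ((2*x)^2 * f (2 * x)) := by
    funext x; ring
  refine ⟨by have := hf.cont; fun_prop, fun x => hf.nonneg _, fun x => ?_,
    hf.int.comp_mul_left' two_ne_zero, ⟨K, fun x => hK _⟩, ?_, ?_, ?_⟩
  · rw [← hf.even]; congr 1; ring
  · rw [Measure.integral_comp_mul_left, hf.mass]
    norm_num [abs_of_pos]; ring
  · rw [e]
    exact (hf.int2.comp_mul_left' two_ne_zero).const_mul _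
  · rw [e, integral_const_mul, Measure.integral_comp_mul_left (fun x => x^2 * f x), hf.mom]
    norm_num [abs_of_pos]; ring

theorem PB_exp : PB (fun x => Real.exp (-|x|)) 2 4 := by
  have h1 : ∫ x : ℝ, Real.exp (-|x|) = 2 := by
    rw [integral_comp_abs (f := fun x => Real.exp (-x)), integral_exp_neg_Ioi_zero]; norm_num
  have h2 : ∫ x : ℝ, x^2 * Real.exp (-|x|) = 4 := by
    have e : (fun x : ℝ => x^2 * Real.exp (-|x|)) = fun x => |x|^2 * Real.exp (-|x|) := by
      funext x; rw [sq_abs]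
    rw [e, integral_comp_abs (f := fun x => x^2 * Real.exp (-x))]
    have := Real.integral_rpow_mul_exp_neg_mul_Ioi (a := 3) (r := 1) (by norm_num) (by norm_num)
    have h3 : Real.Gamma 3 = 2 := by
      have h5 := Real.Gamma_nat_eq_factorial 2
      have h6 : ((2 : ℕ) : ℝ) + 1 = 3 := by norm_num
      rw [h6] at h5
      rw [h5]; norm_num [Nat.factorial]
    have h4 : ∫ x in Set.Ioi (0:ℝ), x^2 * Real.exp (-x) = 2 := by
      rw [h3] at this
      norm_num at this
      exact this
    rw [h4]; norm_num
  refine ⟨by fun_prop, fun x => (Real.exp_pos _).le, fun x => by simp,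
    Integrable.of_integral_ne_zero (by rw [h1]; norm_num), ⟨1, fun x => ?_⟩, h1,
    Integrable.of_integral_ne_zero (by rw [h2]; norm_num), h2⟩
  rw [abs_of_pos (Real.exp_pos _)]
  simp

/-- S maps the set B into itself, with the uniform bound S(F) ≤ 1/2. -/
theorem S_maps_B_into_B (F : ℝ → ℝ) (hF : memB F) :
    memB (S F) ∧ ∀ ξ : ℝ, S F ξ ≤ 1/2 := by
  obtain ⟨h1, h2, h3, h4, h5, h6, h7, h8⟩ := hF
  have hP : PB F 1 4 := ⟨h1, h2, h3, h4, h5, h6, h7, h8⟩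
  have hG := (hP.cv hP).scale
  have hS := PB_exp.cv hG
  have e : S F = cv (fun x => Real.exp (-|x|)) (fun x => cv F F (2 * x)) := by
    funext ξ
    simp only [S, cv, mul_assoc, integral_const_mul]
  rw [← e] at hS
  norm_num at hS
  refine ⟨⟨hS.cont, hS.nonneg, hS.even, hS.int, hS.bdd, hS.mass, hS.int2, hS.mom⟩, fun ξ => ?_⟩
  have hm := hG.mass
  norm_num at hm
  rw [e, one_div, ← one_div, ← hm]
  have hle : ∀ t : ℝ, Real.exp (-|ξ - t|) ≤ 1 := fun t => by simp
  refine integral_mono (hG.int.bdd_mul (c := 1) (by fun_prop) (ae_of_all _ fun t => ?_)) hG.int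
    fun t => mul_le_of_le_one_left (hG.nonneg t) (hle t)
  rw [Real.norm_eq_abs, abs_of_pos (Real.exp_pos _)]
  exact hle t
end
end

section
/- For every F ∈ B, the function S(F) is Lipschitz continuous with Lipschitz constant 1/2: for all ξ₁, ξ₂ ∈ ℝ, |S(F)(ξ₁) − S(F)(ξ₂)| ≤ (1/2)|ξ₁ − ξ₂|. -/
open MeasureTheory Real Filter

noncomputable section

lemma abs_exp_neg_abs_sub_le (a b : ℝ) :
    |Real.exp (-|a|) - Real.exp (-|b|)| ≤ |a - b| := by
  have key : ∀ x y : ℝ, Real.exp (-|x|) - Real.exp (-|y|) ≤ |x - y| := by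
    intro x y
    have h1 : Real.exp (-|x|) ≤ 1 := Real.exp_le_one_iff.2 (by simp)
    have h2 : (|x| - |y|) + 1 ≤ Real.exp (|x| - |y|) := Real.add_one_le_exp _
    have h3 : Real.exp (-|y|) = Real.exp (-|x|) * Real.exp (|x| - |y|) := by
      rw [← Real.exp_add]; ring_nf
    have h4 : |y| - |x| ≤ |x - y| := by
      rw [abs_sub_comm x y]; exact abs_sub_abs_le_abs_sub y x
    have h5 := Real.exp_pos (-|x|)
    have h6 := abs_nonneg (x - y)
    rw [h3]
    nlinarith
  rw [abs_le]
  have h1 := key a b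
  have h2 := key b a
  rw [abs_sub_comm b a] at h2
  constructor <;> linarith

/-- For F ∈ B, S(F) is Lipschitz continuous with constant 1/2. -/
theorem S_lipschitz_half (F : ℝ → ℝ) (hF : memB F) :
    ∀ ξ₁ ξ₂ : ℝ, |S F ξ₁ - S F ξ₂| ≤ (1/2) * |ξ₁ - ξ₂| := by
  intro ξ₁ ξ₂
  obtain ⟨hc, hpos, -, hint, -, h1, -, -⟩ := hF
  set h : ℝ → ℝ := fun x => ∫ ζ : ℝ, F ζ * F (x - ζ) with hh
  have hconv : h = convolution F F (ContinuousLinearMap.mul ℝ ℝ) volume := by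
    funext x; simp [hh, convolution]
  have hi : Integrable h := by
    rw [hconv]; exact hint.integrable_convolution _ hint
  have hI : ∫ x, h x = 1 := by
    rw [hconv, integral_convolution _ hint hint, h1]; simp
  have hGi : Integrable (fun η : ℝ => h (2 * η)) := hi.comp_mul_left' two_ne_zero
  have hGI : ∫ η : ℝ, h (2 * η) = 1 / 2 := by
    rw [Measure.integral_comp_mul_left, hI]; norm_num
  have hGpos : ∀ x, 0 ≤ h x := fun x =>
    integral_nonneg fun ζ => mul_nonneg (hpos _) (hpos _)
  have hS : ∀ ξ, S F ξ = ∫ η : ℝ, Real.exp (-|ξ - η|) * h (2 * η) := by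
    intro ξ
    simp only [S, hh]
    congr 1; funext η
    rw [← integral_const_mul]
    congr 1; funext ζ; ring
  have hSi : ∀ ξ, Integrable (fun η : ℝ => Real.exp (-|ξ - η|) * h (2 * η)) := by
    intro ξ
    refine hGi.bdd_mul (c := 1) (by fun_prop) (Eventually.of_forall fun η => ?_)
    rw [Real.norm_eq_abs, abs_of_pos (Real.exp_pos _)]
    exact Real.exp_le_one_iff.2 (by simp)
  rw [hS, hS, ← integral_sub (hSi _) (hSi _), ← hGI, mul_comm, ← integral_const_mul,
    ← Real.norm_eq_abs]
  refine norm_integral_le_of_norm_le (hGi.const_mul _) (Eventually.of_forall fun η => ?_)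
  rw [← sub_mul, norm_mul, Real.norm_eq_abs, Real.norm_eq_abs, abs_of_nonneg (hGpos _)]
  refine mul_le_mul_of_nonneg_right ?_ (hGpos _)
  have := abs_exp_neg_abs_sub_le (ξ₁ - η) (ξ₂ - η)
  rwa [sub_sub_sub_cancel_right] at this
end
end

section
/- The map S is Lipschitz continuous on B with respect to the supremum norm with constant 4: for all F₁, F₂ ∈ B and all ξ ∈ ℝ, |S(F₁)(ξ) − S(F₂)(ξ)| ≤ 4 sup_{η ∈ ℝ} |F₁(η) − F₂(η)|. -/
open MeasureTheory Real Filter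

noncomputable section

theorem S_aux (F : ℝ → ℝ) (K : ℝ) (c : Continuous F) (n : ∀ ξ, 0 ≤ F ξ)
    (i : Integrable F) (k : ∀ ξ, |F ξ| ≤ K) (m : (∫ ξ : ℝ, F ξ) = 1) (ξ : ℝ)
    (hEi : Integrable (fun η : ℝ => Real.exp (-|ξ - η|))) :
    (∀ η : ℝ, Integrable (fun ζ : ℝ => Real.exp (-|ξ - η|) * F (2*η - ζ) * F ζ)) ∧
    Integrable (fun η : ℝ => ∫ ζ : ℝ, Real.exp (-|ξ - η|) * F (2*η - ζ) * F ζ) := by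
  have hbd : ∀ η ζ : ℝ, ‖Real.exp (-|ξ - η|) * F (2*η - ζ) * F ζ‖
      ≤ Real.exp (-|ξ - η|) * K * F ζ := by
    intro η ζ
    rw [Real.norm_eq_abs, abs_mul, abs_mul, abs_of_pos (Real.exp_pos _), abs_of_nonneg (n ζ)]
    exact mul_le_mul_of_nonneg_right
      (mul_le_mul_of_nonneg_left (k _) (Real.exp_pos _).le) (n ζ)
  refine ⟨fun η => ?_, ?_⟩
  · refine (i.const_mul (Real.exp (-|ξ - η|) * K)).mono' ?_ (Eventually.of_forall (hbd η))
    exact (by fun_prop : Continuous _).aestronglyMeasurable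
  · refine (hEi.mul_const K).mono' ?_ (Eventually.of_forall fun η => ?_)
    · have hc : Continuous (fun p : ℝ × ℝ =>
        Real.exp (-|ξ - p.1|) * F (2*p.1 - p.2) * F p.2) := by fun_prop
      exact hc.stronglyMeasurable.integral_prod_right'.aestronglyMeasurable
    · refine (norm_integral_le_of_norm_le (i.const_mul _)
        (Eventually.of_forall (hbd η))).trans ?_
      rw [integral_const_mul, m, mul_one]

/-- S is Lipschitz continuous on B with constant 4 with respect to the sup norm. -/
theorem S_sup_lipschitz (F₁ F₂ : ℝ → ℝ) (h₁ : memB F₁) (h₂ : memB F₂) :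
    ∀ ξ : ℝ, |S F₁ ξ - S F₂ ξ| ≤ 4 * ⨆ η : ℝ, |F₁ η - F₂ η| := by
  intro ξ
  obtain ⟨c₁, n₁, -, i₁, ⟨K₁, k₁⟩, m₁, -, -⟩ := h₁
  obtain ⟨c₂, n₂, -, i₂, ⟨K₂, k₂⟩, m₂, -, -⟩ := h₂
  set M := ⨆ η : ℝ, |F₁ η - F₂ η| with hM
  have hbdd : BddAbove (Set.range fun η : ℝ => |F₁ η - F₂ η|) := by
    refine ⟨K₁ + K₂, ?_⟩
    rintro _ ⟨η, rfl⟩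
    exact (abs_sub _ _).trans (add_le_add (k₁ η) (k₂ η))
  have hle : ∀ η, |F₁ η - F₂ η| ≤ M := fun η => le_ciSup hbdd η
  have hE : ∫ η : ℝ, Real.exp (-|ξ - η|) = 2 := by
    rw [integral_sub_left_eq_self (fun x : ℝ => Real.exp (-|x|)) volume ξ,
      integral_comp_abs (f := fun x : ℝ => Real.exp (-x)), integral_exp_neg_Ioi_zero]
    norm_num
  have hEi : Integrable (fun η : ℝ => Real.exp (-|ξ - η|)) :=
    Integrable.of_integral_ne_zero (by rw [hE]; norm_num)
  have hS₁ := S_aux F₁ K₁ c₁ n₁ i₁ k₁ m₁ ξ hEi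
  have hS₂ := S_aux F₂ K₂ c₂ n₂ i₂ k₂ m₂ ξ hEi
  unfold S
  rw [← integral_sub hS₁.2 hS₂.2, ← Real.norm_eq_abs]
  have hfin : ∫ η : ℝ, Real.exp (-|ξ - η|) * (2 * M) = 4 * M := by
    rw [integral_mul_const, hE]; ring
  rw [← hfin]
  refine norm_integral_le_of_norm_le (hEi.mul_const _) (Eventually.of_forall fun η => ?_)
  rw [← integral_sub (hS₁.1 η) (hS₂.1 η)]
  have j₁ : Integrable (fun ζ : ℝ => F₁ (2 * η - ζ)) := i₁.comp_sub_left (2 * η)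
  have hb : ∫ ζ : ℝ, Real.exp (-|ξ - η|) * (M * (F₁ (2 * η - ζ) + F₂ ζ))
      = Real.exp (-|ξ - η|) * (2 * M) := by
    rw [integral_const_mul, integral_const_mul, integral_add j₁ i₂,
      integral_sub_left_eq_self F₁ volume (2 * η), m₁, m₂]
    ring
  rw [← hb]
  refine norm_integral_le_of_norm_le (((j₁.add i₂).const_mul M).const_mul _)
    (Eventually.of_forall fun ζ => ?_)
  have e : Real.exp (-|ξ - η|) * F₁ (2 * η - ζ) * F₁ ζ - Real.exp (-|ξ - η|) * F₂ (2 * η - ζ) * F₂ ζ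
      = Real.exp (-|ξ - η|) * (F₁ (2 * η - ζ) * (F₁ ζ - F₂ ζ)
        + (F₁ (2 * η - ζ) - F₂ (2 * η - ζ)) * F₂ ζ) := by ring
  rw [e, Real.norm_eq_abs, abs_mul, abs_of_pos (Real.exp_pos _)]
  refine mul_le_mul_of_nonneg_left ((abs_add_le _ _).trans ?_) (Real.exp_pos _).le
  rw [abs_mul, abs_mul, abs_of_nonneg (n₁ _), abs_of_nonneg (n₂ ζ)]
  nlinarith [mul_le_mul_of_nonneg_left (hle ζ) (n₁ (2 * η - ζ)),
    mul_le_mul_of_nonneg_right (hle (2 * η - ζ)) (n₂ ζ)]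
end
end

section
/- There exists a nonnegative, even, twice continuously differentiable function F ∈ L¹(ℝ) which is Lipschitz continuous with constant 1/2, satisfies ∫_ℝ F(ξ) dξ = 1 and ∫_ℝ ξ² F(ξ) dξ ≤ 4, and solves the stationary equation 0 = F''(ξ) + 2∫_ℝ F(2ξ − ξ*) F(ξ*) dξ* − F(ξ) for all ξ ∈ ℝ. -/
open MeasureTheory Real Filter

/-- The Laplace kernel, fundamental solution of `1 - d²/dx²`. -/
noncomputable def lapG (x : ℝ) : ℝ := Real.exp (-|x|) / 2

lemma lapG_nonneg (x : ℝ) : 0 ≤ lapG x := by unfold lapG; positivity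

lemma lapG_le (x : ℝ) : lapG x ≤ 1 / 2 := by
  unfold lapG
  have : Real.exp (-|x|) ≤ 1 := Real.exp_le_one_iff.2 (by simp)
  linarith

lemma lapG_cont : Continuous lapG := by unfold lapG; fun_prop

lemma lapG_neg (x : ℝ) : lapG (-x) = lapG x := by simp [lapG]

lemma exp_neg_sub_le {a b : ℝ} (ha : 0 ≤ a) (hab : a ≤ b) :
    Real.exp (-a) - Real.exp (-b) ≤ b - a := by
  have h1 : Real.exp (-a) ≤ 1 := Real.exp_le_one_iff.2 (by linarith)
  have h2 := Real.add_one_le_exp (a - b)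
  have h3 : Real.exp (-b) = Real.exp (-a) * Real.exp (a - b) := by
    rw [← Real.exp_add]; congr 1; ring
  have h4 := Real.exp_pos (-a)
  rw [h3]
  nlinarith

lemma lapG_lip (x y : ℝ) : |lapG x - lapG y| ≤ 1 / 2 * |x - y| := by
  have h0 := abs_abs_sub_abs_le_abs_sub x y
  unfold lapG
  have hx := abs_nonneg x
  have hy := abs_nonneg y
  rcases le_total |x| |y| with h | h
  · have h1 := exp_neg_sub_le hx h
    have h2 : Real.exp (-|y|) ≤ Real.exp (-|x|) := Real.exp_le_exp.2 (by linarith)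
    rw [abs_of_nonneg (by linarith)]
    have := neg_abs_le (|x| - |y|)
    linarith
  · have h1 := exp_neg_sub_le hy h
    have h2 : Real.exp (-|x|) ≤ Real.exp (-|y|) := Real.exp_le_exp.2 (by linarith)
    rw [abs_of_nonpos (by linarith)]
    have := le_abs_self (|x| - |y|)
    linarith

lemma lapG_fourier_aux (t : ℝ) :
    (IntegrableOn (fun x : ℝ => Complex.exp (t * x * Complex.I) * (lapG x : ℂ)) (Set.Iic 0) ∧
      ∫ x in Set.Iic (0:ℝ), Complex.exp (t * x * Complex.I) * (lapG x : ℂ)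
        = 1 / (2 * (1 + t * Complex.I))) ∧
    (IntegrableOn (fun x : ℝ => Complex.exp (t * x * Complex.I) * (lapG x : ℂ)) (Set.Ioi 0) ∧
      ∫ x in Set.Ioi (0:ℝ), Complex.exp (t * x * Complex.I) * (lapG x : ℂ)
        = 1 / (2 * (1 - t * Complex.I))) := by
  have e1 : Set.EqOn (fun x : ℝ => Complex.exp (t * x * Complex.I) * (lapG x : ℂ))
      (fun x : ℝ => Complex.exp ((1 + t * Complex.I) * x) / 2) (Set.Iic 0) := by
    intro x hx
    have hx' : x ≤ 0 := hx
    simp only [lapG, abs_of_nonpos hx', neg_neg]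
    push_cast
    rw [← mul_div_assoc, ← Complex.exp_add]
    congr 2; ring
  have e2 : Set.EqOn (fun x : ℝ => Complex.exp (t * x * Complex.I) * (lapG x : ℂ))
      (fun x : ℝ => Complex.exp ((-1 + t * Complex.I) * x) / 2) (Set.Ioi 0) := by
    intro x hx
    have hx' : 0 ≤ x := le_of_lt hx
    simp only [lapG, abs_of_nonneg hx']
    push_cast
    rw [← mul_div_assoc, ← Complex.exp_add]
    congr 2; ring
  refine ⟨⟨?_, ?_⟩, ?_, ?_⟩
  · rw [integrableOn_congr_fun e1 measurableSet_Iic]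
    exact (integrableOn_exp_mul_complex_Iic (by simp) 0).div_const 2
  · rw [setIntegral_congr_fun measurableSet_Iic e1, integral_div,
      integral_exp_mul_complex_Iic (by simp)]
    simp
    ring
  · rw [integrableOn_congr_fun e2 measurableSet_Ioi]
    exact (integrableOn_exp_mul_complex_Ioi (by simp) 0).div_const 2
  · rw [setIntegral_congr_fun measurableSet_Ioi e2, integral_div,
      integral_exp_mul_complex_Ioi (by simp)]
    have : (-1 + t * Complex.I : ℂ) = -(1 - t * Complex.I) := by ring
    rw [this, neg_div_neg_eq, Complex.ofReal_zero, mul_zero, Complex.exp_zero,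
      one_div, one_div, mul_inv]
    ring

lemma lapG_fourier (t : ℝ) :
    ∫ x : ℝ, Complex.exp (t * x * Complex.I) * (lapG x : ℂ) = ((1 / (1 + t ^ 2) : ℝ) : ℂ) := by
  obtain ⟨⟨i1, h1⟩, i2, h2⟩ := lapG_fourier_aux t
  have := setIntegral_union (Set.Iic_disjoint_Ioi le_rfl) measurableSet_Ioi i1 i2
  rw [Set.Iic_union_Ioi, setIntegral_univ] at this
  rw [this, h1, h2]
  have n1 : (1 + t * Complex.I : ℂ) ≠ 0 := by
    intro h; simpa using congrArg Complex.re h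
  have n2 : (1 - t * Complex.I : ℂ) ≠ 0 := by
    intro h; simpa using congrArg Complex.re h
  have n3 : (1 + (t : ℂ) ^ 2) = (1 + t * Complex.I) * (1 - t * Complex.I) := by
    ring_nf; simp
  push_cast
  rw [n3]
  field_simp
  ring

lemma lapG_integrable : Integrable lapG := by
  obtain ⟨⟨i1, h1⟩, i2, h2⟩ := lapG_fourier_aux 0
  have := i1.union i2
  rw [Set.Iic_union_Ioi, integrableOn_univ] at this
  simpa using this.re

lemma lapG_integral : ∫ x, lapG x = 1 := by
  have := lapG_fourier 0
  simp only [Complex.ofReal_zero, zero_mul, Complex.exp_zero, one_mul] at this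
  rw [integral_complex_ofReal] at this
  have := Complex.ofReal_injective this
  simpa using this

/-- The Laplace distribution. -/
noncomputable def lapM : Measure ℝ := volume.withDensity (fun x => ENNReal.ofReal (lapG x))

instance : IsProbabilityMeasure lapM := by
  constructor
  rw [lapM, withDensity_apply _ MeasurableSet.univ, setLIntegral_univ,
    ← ofReal_integral_eq_lintegral_ofReal lapG_integrable (ae_of_all _ lapG_nonneg), lapG_integral]
  simp

lemma lapM_charFun (t : ℝ) : charFun lapM t = ((1 / (1 + t ^ 2) : ℝ) : ℂ) := by
  rw [charFun_apply_real, ← lapG_fourier, lapM,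
    integral_withDensity_eq_integral_toReal_smul₀ (by have := lapG_cont; fun_prop) (by simp)]
  congr 1 with x
  rw [ENNReal.toReal_ofReal (lapG_nonneg x)]
  simp [mul_comm]

/-- Law of half the sum of two independent copies. -/
noncomputable def halfSum (μ : Measure ℝ) : Measure ℝ := (μ ∗ μ).map (fun x => 2⁻¹ * x)

instance (μ : Measure ℝ) [IsProbabilityMeasure μ] : IsProbabilityMeasure (halfSum μ) :=
  Measure.isProbabilityMeasure_map (by fun_prop)

lemma halfSum_charFun (μ : Measure ℝ) [IsProbabilityMeasure μ] (t : ℝ) :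
    charFun (halfSum μ) t = charFun μ (2⁻¹ * t) ^ 2 := by
  rw [halfSum, charFun_map_mul, charFun_conv, sq]

/-- Characteristic functions of the iterates. -/
noncomputable def phiSeq : ℕ → ℝ → ℝ
  | 0, _ => 1
  | n + 1, t => 1 / (1 + t ^ 2) * phiSeq n (2⁻¹ * t) ^ 2

lemma phiSeq_bounds (n : ℕ) (t : ℝ) :
    0 ≤ phiSeq n t ∧ phiSeq n t ≤ 1 ∧ 1 - 2 * t ^ 2 ≤ phiSeq n t := by
  induction n generalizing t with
  | zero => simp only [phiSeq]; refine ⟨by norm_num, by norm_num, by nlinarith [sq_nonneg t]⟩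
  | succ n ih =>
    obtain ⟨h0, h1, h2⟩ := ih (2⁻¹ * t)
    simp only [phiSeq]
    set a := phiSeq n (2⁻¹ * t)
    have ha : a ^ 2 ≤ 1 := by nlinarith
    have hp : 0 < 1 + t ^ 2 := by positivity
    refine ⟨by positivity, ?_, ?_⟩
    · rw [div_mul_eq_mul_div, one_mul, div_le_one hp]
      nlinarith [sq_nonneg t]
    · rw [div_mul_eq_mul_div, one_mul, le_div_iff₀ hp]
      have h3 : 1 - t ^ 2 ≤ a ^ 2 := by nlinarith [sq_nonneg (a - 1)]
      nlinarith [sq_nonneg t, sq_nonneg (t ^ 2)]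

lemma phiSeq_anti (n : ℕ) (t : ℝ) : phiSeq (n + 1) t ≤ phiSeq n t := by
  induction n generalizing t with
  | zero => exact (phiSeq_bounds 1 t).2.1
  | succ n ih =>
    have h := ih (2⁻¹ * t)
    have h0 := (phiSeq_bounds (n + 1) (2⁻¹ * t)).1
    change 1 / (1 + t ^ 2) * phiSeq (n + 1) (2⁻¹ * t) ^ 2 ≤ 1 / (1 + t ^ 2) * phiSeq n (2⁻¹ * t) ^ 2
    gcongr

lemma phiSeq_charFun (n : ℕ) :
    ∃ μ : ProbabilityMeasure ℝ, ∀ t, charFun (μ : Measure ℝ) t = (phiSeq n t : ℂ) := by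
  induction n with
  | zero => exact ⟨⟨Measure.dirac 0, inferInstance⟩, fun t => by simp [charFun_dirac, phiSeq]⟩
  | succ n ih =>
    obtain ⟨μ, hμ⟩ := ih
    refine ⟨⟨lapM ∗ halfSum μ, inferInstance⟩, fun t => ?_⟩
    simp only [ProbabilityMeasure.coe_mk]
    rw [charFun_conv, lapM_charFun, halfSum_charFun, hμ, phiSeq]
    push_cast
    rfl

lemma exists_fixed_measure : ∃ (μ : Measure ℝ) (φ : ℝ → ℝ), IsProbabilityMeasure μ ∧
    (∀ t, charFun μ t = (φ t : ℂ)) ∧ (∀ t, 1 - 2 * t ^ 2 ≤ φ t) ∧ μ = halfSum μ ∗ lapM := by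
  choose μ hμ using phiSeq_charFun
  have hlim : ∀ t, ∃ l, Tendsto (fun n => phiSeq n t) atTop (nhds l) := fun t =>
    ⟨_, tendsto_atTop_ciInf (antitone_nat_of_succ_le (fun n => phiSeq_anti n t))
      ⟨0, by rintro _ ⟨n, rfl⟩; exact (phiSeq_bounds n t).1⟩⟩
  choose φ hφ using hlim
  have hφ1 : ∀ t, φ t ≤ 1 := fun t => le_of_tendsto' (hφ t) fun n => (phiSeq_bounds n t).2.1
  have hφ2 : ∀ t, 1 - 2 * t ^ 2 ≤ φ t :=
    fun t => ge_of_tendsto' (hφ t) fun n => (phiSeq_bounds n t).2.2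
  have hrec : ∀ t, φ t = 1 / (1 + t ^ 2) * φ (2⁻¹ * t) ^ 2 := fun t =>
    tendsto_nhds_unique ((tendsto_add_atTop_iff_nat 1).2 (hφ t))
      (((hφ (2⁻¹ * t)).pow 2).const_mul (1 / (1 + t ^ 2)))
  have hφ0 : φ 0 = 1 := le_antisymm (hφ1 0) (by simpa using hφ2 0)
  have hcont : ContinuousAt φ 0 := by
    rw [ContinuousAt, hφ0]
    refine tendsto_of_tendsto_of_tendsto_of_le_of_le (g := fun t => 1 - 2 * t ^ 2)
      (h := fun _ => 1) ?_ tendsto_const_nhds hφ2 hφ1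
    have : Continuous (fun t : ℝ => 1 - 2 * t ^ 2) := by fun_prop
    simpa using this.tendsto 0
  have hconv : ∀ t, Tendsto (fun n => charFun (μ n : Measure ℝ) t) atTop (nhds (φ t : ℂ)) := by
    intro t
    simp only [hμ]
    exact (Complex.continuous_ofReal.tendsto _).comp (hφ t)
  have htight := isTightMeasureSet_of_tendsto_charFun (μ := fun n => (μ n : Measure ℝ))
    (f := fun t => (φ t : ℂ)) (Complex.continuous_ofReal.continuousAt.comp hcont) hconv
  have hcomp : IsCompact (closure (Set.range μ)) :=
    isCompact_closure_of_isTightMeasureSet (by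
      convert htight using 1
      ext; simp)
  let U : Ultrafilter ℕ := Ultrafilter.of atTop
  have hU : (U : Filter ℕ) ≤ atTop := Ultrafilter.of_le _
  obtain ⟨μ', -, hμ'⟩ := hcomp.ultrafilter_le_nhds (U.map μ)
    (.trans (by simp) (monotone_principal subset_closure))
  have hμ'' : Tendsto μ U (nhds μ') := hμ'
  have hchar : ∀ t, charFun (μ' : Measure ℝ) t = (φ t : ℂ) := by
    intro t
    rw [ProbabilityMeasure.tendsto_iff_forall_integral_rclike_tendsto ℂ] at hμ''
    have h1 := hμ'' (BoundedContinuousFunction.innerProbChar t)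
    simp_rw [← charFun_eq_integral_innerProbChar] at h1
    exact tendsto_nhds_unique h1 ((hconv t).mono_left hU)
  refine ⟨μ', φ, inferInstance, hchar, hφ2, ?_⟩
  apply Measure.ext_of_charFun
  ext t
  rw [charFun_conv, lapM_charFun, halfSum_charFun, hchar, hchar, hrec t]
  push_cast
  ring

lemma ode_kernel (H : ℝ → ℝ) (hc : Continuous H) (hb : ∀ x, |H x| ≤ 1) :
    ∃ F' : ℝ → ℝ, (∀ x, HasDerivAt (fun x => ∫ y, lapG (x - y) * H y) (F' x) x) ∧
      ∀ x, HasDerivAt F' ((∫ y, lapG (x - y) * H y) - H x) x := by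
  have i1 : ∀ x, IntegrableOn (fun y => Real.exp y * H y) (Set.Iic x) := fun x =>
    (integrableOn_exp_Iic x).mul_bdd (c := 1) hc.aestronglyMeasurable (ae_of_all _ hb)
  have i2 : ∀ x, IntegrableOn (fun y => Real.exp (-y) * H y) (Set.Ioi x) := fun x =>
    (integrableOn_exp_neg_Ioi x).mul_bdd (c := 1) hc.aestronglyMeasurable (ae_of_all _ hb)
  set A : ℝ → ℝ := fun x => ∫ y in Set.Iic x, Real.exp y * H y with hA
  set B : ℝ → ℝ := fun x => ∫ y in Set.Ioi x, Real.exp (-y) * H y with hB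
  have dA : ∀ x, HasDerivAt A (Real.exp x * H x) x := by
    intro x
    have e : A = fun x => A 0 + ∫ y in (0:ℝ)..x, Real.exp y * H y := by
      ext x
      have := intervalIntegral.integral_Iic_sub_Iic (i1 0) (i1 x)
      simp only [hA]
      linarith
    rw [e]
    refine HasDerivAt.const_add _ ?_
    have hcc : Continuous (fun y => Real.exp y * H y) := by fun_prop
    exact intervalIntegral.integral_hasDerivAt_right (hcc.intervalIntegrable _ _)
      (hcc.stronglyMeasurableAtFilter _ _) hcc.continuousAt
  have dB : ∀ x, HasDerivAt B (-(Real.exp (-x) * H x)) x := by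
    intro x
    have e : B = fun x => B 0 - ∫ y in (0:ℝ)..x, Real.exp (-y) * H y := by
      ext x
      have := intervalIntegral.integral_interval_add_Ioi (i2 0) (i2 x)
      simp only [hB]
      linarith
    rw [e]
    refine HasDerivAt.const_sub _ ?_
    have hcc : Continuous (fun y => Real.exp (-y) * H y) := by fun_prop
    exact intervalIntegral.integral_hasDerivAt_right (hcc.intervalIntegrable _ _)
      (hcc.stronglyMeasurableAtFilter _ _) hcc.continuousAt
  have eF : ∀ x, ∫ y, lapG (x - y) * H y
      = Real.exp (-x) / 2 * A x + Real.exp x / 2 * B x := by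
    intro x
    have e1 : Set.EqOn (fun y => lapG (x - y) * H y)
        (fun y => Real.exp (-x) / 2 * (Real.exp y * H y)) (Set.Iic x) := by
      intro y hy
      have hy' : y ≤ x := hy
      simp only [lapG, abs_of_nonneg (sub_nonneg.2 hy')]
      rw [show -(x - y) = -x + y by ring, Real.exp_add]
      ring
    have e2 : Set.EqOn (fun y => lapG (x - y) * H y)
        (fun y => Real.exp x / 2 * (Real.exp (-y) * H y)) (Set.Ioi x) := by
      intro y hy
      have hy' : x ≤ y := le_of_lt hy
      simp only [lapG, abs_of_nonpos (sub_nonpos.2 hy')]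
      rw [show - -(x - y) = x + -y by ring, Real.exp_add]
      ring
    have j1 : IntegrableOn (fun y => lapG (x - y) * H y) (Set.Iic x) := by
      rw [integrableOn_congr_fun e1 measurableSet_Iic]
      exact (i1 x).const_mul _
    have j2 : IntegrableOn (fun y => lapG (x - y) * H y) (Set.Ioi x) := by
      rw [integrableOn_congr_fun e2 measurableSet_Ioi]
      exact (i2 x).const_mul _
    have := setIntegral_union (Set.Iic_disjoint_Ioi le_rfl) measurableSet_Ioi j1 j2
    rw [Set.Iic_union_Ioi, setIntegral_univ] at this
    rw [this, setIntegral_congr_fun measurableSet_Iic e1,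
      setIntegral_congr_fun measurableSet_Ioi e2, integral_const_mul, integral_const_mul]
  have hm : ∀ x : ℝ, HasDerivAt (fun x => Real.exp (-x) / 2) (-(Real.exp (-x)) / 2) x := by
    intro x
    simpa using ((hasDerivAt_neg x).exp).div_const 2
  have hp : ∀ x : ℝ, HasDerivAt (fun x => Real.exp x / 2) (Real.exp x / 2) x := fun x =>
    (Real.hasDerivAt_exp x).div_const 2
  have hpm : ∀ x : ℝ, Real.exp (-x) * Real.exp x = 1 := fun x => by
    rw [← Real.exp_add]; simp
  refine ⟨fun x => -(Real.exp (-x) / 2 * A x) + Real.exp x / 2 * B x, fun x => ?_, fun x => ?_⟩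
  · simp_rw [eF]
    refine (((hm x).mul (dA x)).add ((hp x).mul (dB x))).congr_deriv ?_
    linear_combination 0 * hpm x
  · rw [eF]
    refine (((hm x).mul (dA x)).neg.add ((hp x).mul (dB x))).congr_deriv ?_
    linear_combination (-H x) * hpm x

section Profile

variable (μ : Measure ℝ) [IsProbabilityMeasure μ]

/-- The density of `halfSum μ ∗ lapM`. -/
noncomputable def prof (ξ : ℝ) : ℝ := ∫ y, lapG (ξ - y) ∂(halfSum μ)

lemma prof_int (ξ : ℝ) : Integrable (fun y => lapG (ξ - y)) (halfSum μ) := by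
  have := lapG_cont
  refine Integrable.of_bound (C := 1 / 2) (by fun_prop) (ae_of_all _ fun y => ?_)
  rw [Real.norm_of_nonneg (lapG_nonneg _)]
  exact lapG_le _

lemma prof_nonneg (ξ : ℝ) : 0 ≤ prof μ ξ := integral_nonneg fun _ => lapG_nonneg _

lemma prof_le (ξ : ℝ) : prof μ ξ ≤ 1 / 2 := by
  have := integral_mono (prof_int μ ξ) (integrable_const (1 / 2 : ℝ)) fun y => lapG_le (ξ - y)
  simpa [prof] using this

lemma prof_lip (x y : ℝ) : |prof μ x - prof μ y| ≤ 1 / 2 * |x - y| := by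
  rw [prof, prof, ← integral_sub (prof_int μ x) (prof_int μ y)]
  have := norm_integral_le_of_norm_le_const (μ := halfSum μ)
    (f := fun z => lapG (x - z) - lapG (y - z)) (C := 1 / 2 * |x - y|)
    (ae_of_all _ fun z => by
      have := lapG_lip (x - z) (y - z)
      simpa using this)
  simpa using this

lemma prof_cont : Continuous (prof μ) := by
  have : LipschitzWith (1 / 2) (prof μ) := LipschitzWith.of_dist_le_mul fun x y => by
    simpa [Real.dist_eq] using prof_lip μ x y
  exact this.continuous

lemma prof_even {φ : ℝ → ℝ} (hφ : ∀ t, charFun μ t = (φ t : ℂ)) (ξ : ℝ) :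
    prof μ (-ξ) = prof μ ξ := by
  have hs : (halfSum μ).map (fun x => (-1) * x) = halfSum μ := by
    have : IsProbabilityMeasure ((halfSum μ).map (fun x => (-1) * x)) :=
      Measure.isProbabilityMeasure_map (by fun_prop)
    apply Measure.ext_of_charFun
    ext t
    rw [charFun_map_mul, neg_one_mul, charFun_neg, halfSum_charFun, hφ, map_pow, Complex.conj_ofReal]
  have hc := lapG_cont
  rw [prof, prof]
  conv_rhs => rw [← hs]
  rw [integral_map (by fun_prop) (by fun_prop)]
  congr 1 with y
  rw [← lapG_neg]
  congr 1
  ring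

variable {μ}

lemma prof_withDensity (h : μ = halfSum μ ∗ lapM) :
    μ = volume.withDensity (fun x => ENNReal.ofReal (prof μ x)) := by
  have hc := lapG_cont
  conv_lhs => rw [h]
  have e : ∀ x, ENNReal.ofReal (prof μ x) = ∫⁻ y, ENNReal.ofReal (lapG (x - y)) ∂(halfSum μ) :=
    fun x => ofReal_integral_eq_lintegral_ofReal (prof_int μ x) (ae_of_all _ fun _ => lapG_nonneg _)
  refine Measure.ext_of_lintegral _ fun f hf => ?_
  rw [Measure.lintegral_conv hf, lintegral_withDensity_eq_lintegral_mul _ (by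
    have := prof_cont μ; fun_prop) hf]
  have e1 : ∀ x, ∫⁻ y, f (x + y) ∂lapM = ∫⁻ z, ENNReal.ofReal (lapG (z - x)) * f z := by
    intro x
    rw [lapM, lintegral_withDensity_eq_lintegral_mul _ (by fun_prop) (by fun_prop),
      ← lintegral_add_right_eq_self (μ := volume)
        (fun z => ENNReal.ofReal (lapG (z - x)) * f z) x]
    simp [add_comm]
  simp_rw [e1]
  rw [lintegral_lintegral_swap (by fun_prop)]
  congr 1 with z
  rw [lintegral_mul_const _ (by fun_prop), Pi.mul_apply, e]

lemma prof_integral (h : μ = halfSum μ ∗ lapM) :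
    Integrable (prof μ) ∧ ∫ x, prof μ x = 1 := by
  have hd := prof_withDensity h
  have h1 : ∫⁻ x, ENNReal.ofReal (prof μ x) = 1 := by
    have : μ Set.univ = 1 := measure_univ
    rw [hd, withDensity_apply _ MeasurableSet.univ, setLIntegral_univ] at this
    exact this
  have hi : Integrable (prof μ) := by
    refine ⟨(prof_cont μ).aestronglyMeasurable, ?_⟩
    rw [hasFiniteIntegral_iff_ofReal (ae_of_all _ (prof_nonneg μ)), h1]
    exact ENNReal.one_lt_top
  refine ⟨hi, ?_⟩
  rw [integral_eq_lintegral_of_nonneg_ae (ae_of_all _ (prof_nonneg μ)) hi.1, h1]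
  simp

lemma integral_prof (h : μ = halfSum μ ∗ lapM) (f : ℝ → ℝ) :
    ∫ x, f x ∂μ = ∫ x, f x * prof μ x := by
  conv_lhs => rw [prof_withDensity h]
  rw [integral_withDensity_eq_integral_toReal_smul₀ (by have := prof_cont μ; fun_prop) (by simp)]
  congr 1 with x
  rw [ENNReal.toReal_ofReal (prof_nonneg μ x), smul_eq_mul, mul_comm]

/-- The collision gain term. -/
noncomputable def gain (μ : Measure ℝ) (ξ : ℝ) : ℝ := 2 * ∫ ζ, prof μ (2 * ξ - ζ) * prof μ ζ

lemma gain_cont (h : μ = halfSum μ ∗ lapM) : Continuous (gain μ) := by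
  have hc := prof_cont μ
  obtain ⟨hi, -⟩ := prof_integral h
  refine Continuous.mul continuous_const ?_
  refine continuous_of_dominated (bound := fun ζ => 1 / 2 * prof μ ζ) (fun x => by fun_prop)
    (fun x => ae_of_all _ fun ζ => ?_) (hi.const_mul _) (ae_of_all _ fun ζ => by fun_prop)
  rw [Real.norm_of_nonneg (mul_nonneg (prof_nonneg μ _) (prof_nonneg μ _))]
  exact mul_le_mul_of_nonneg_right (prof_le μ _) (prof_nonneg μ _)

lemma gain_bound (h : μ = halfSum μ ∗ lapM) (x : ℝ) : |gain μ x| ≤ 1 := by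
  obtain ⟨hi, h1⟩ := prof_integral h
  have h0 : 0 ≤ ∫ ζ, prof μ (2 * x - ζ) * prof μ ζ :=
    integral_nonneg fun ζ => mul_nonneg (prof_nonneg μ _) (prof_nonneg μ _)
  have h2 : ∫ ζ, prof μ (2 * x - ζ) * prof μ ζ ≤ ∫ ζ, 1 / 2 * prof μ ζ :=
    integral_mono_of_nonneg (ae_of_all _ fun ζ => mul_nonneg (prof_nonneg μ _) (prof_nonneg μ _))
      (hi.const_mul _)
      (ae_of_all _ fun ζ => mul_le_mul_of_nonneg_right (prof_le μ _) (prof_nonneg μ _))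
  rw [integral_const_mul, h1] at h2
  rw [gain, abs_of_nonneg (by positivity)]
  linarith

lemma prof_eq (h : μ = halfSum μ ∗ lapM) (ξ : ℝ) :
    prof μ ξ = ∫ y, lapG (ξ - y) * gain μ y := by
  have hG := lapG_cont
  have hc := prof_cont μ
  obtain ⟨hi, h1⟩ := prof_integral h
  have s1 : prof μ ξ = ∫ b, ∫ a, lapG (ξ - 2⁻¹ * (b + a)) ∂μ ∂μ := by
    rw [prof, halfSum, integral_map (by fun_prop) (by fun_prop), integral_conv]
    refine Integrable.of_bound (C := 1 / 2) (by fun_prop) (ae_of_all _ fun y => ?_)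
    rw [Real.norm_of_nonneg (lapG_nonneg _)]
    exact lapG_le _
  have s2 : ∀ b, ∫ a, lapG (ξ - 2⁻¹ * (b + a)) ∂μ
      = ∫ y, 2 * (lapG (ξ - y) * prof μ (2 * y - b)) := by
    intro b
    rw [integral_prof h, integral_const_mul]
    have t1 := integral_sub_right_eq_self (μ := volume)
      (fun a => lapG (ξ - 2⁻¹ * (b + a)) * prof μ a) b
    have t2 := Measure.integral_comp_mul_left
      (fun a => lapG (ξ - 2⁻¹ * (b + (a - b))) * prof μ (a - b)) 2
    rw [← t1]
    have t3 : ∀ y : ℝ, ξ - 2⁻¹ * (b + (2 * y - b)) = ξ - y := fun y => by ring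
    simp only [t3] at t2
    rw [t2]
    simp
  rw [s1, integral_prof h]
  simp_rw [s2, ← integral_mul_const]
  rw [integral_integral_swap]
  · congr 1 with y
    rw [gain, ← mul_assoc, ← integral_const_mul]
    congr 1 with b
    ring
  · have hb : Integrable (fun p : ℝ × ℝ => prof μ p.1 * lapG (ξ - p.2)) (volume.prod volume) :=
      hi.mul_prod (lapG_integrable.comp_sub_left ξ)
    refine hb.mono' (by unfold Function.uncurry; fun_prop) (ae_of_all _ fun p => ?_)
    have q1 := prof_nonneg μ p.1
    have q2 := prof_nonneg μ (2 * p.2 - p.1)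
    have q3 := lapG_nonneg (ξ - p.2)
    have q4 := prof_le μ (2 * p.2 - p.1)
    simp only [Function.uncurry]
    rw [Real.norm_of_nonneg (by positivity)]
    have := mul_nonneg q1 q3
    nlinarith

lemma second_moment {φ : ℝ → ℝ} (hφ : ∀ t, charFun μ t = (φ t : ℂ))
    (hφ2 : ∀ t, 1 - 2 * t ^ 2 ≤ φ t) : ∫⁻ x, ENNReal.ofReal (x ^ 2) ∂μ ≤ 4 := by
  have hcos : ∀ t, ∫ x, Real.cos (t * x) ∂μ = φ t := by
    intro t
    have h1 := hφ t
    rw [charFun_apply_real] at h1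
    have h2 := congrArg Complex.re h1
    have hint : Integrable (fun x : ℝ => Complex.exp (t * x * Complex.I)) μ := by
      refine Integrable.of_bound (C := 1) (by fun_prop) (ae_of_all _ fun x => ?_)
      rw [← Complex.ofReal_mul, Complex.norm_exp_ofReal_mul_I]
    have h3 := integral_re hint
    simp only [RCLike.re_to_complex] at h3
    rw [← h3, Complex.ofReal_re] at h2
    rw [← h2]
    congr 1 with x
    rw [← Complex.ofReal_mul, Complex.exp_ofReal_mul_I_re]
  have hcosi : ∀ t : ℝ, Integrable (fun x => Real.cos (t * x)) μ := fun t =>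
    Integrable.of_bound (C := 1) (by fun_prop) (ae_of_all _ fun x => by
      simpa using Real.abs_cos_le_one _)
  have hbd : ∀ t : ℝ, t ≠ 0 →
      ∫⁻ x, ENNReal.ofReal (x ^ 2 * Real.sinc (t * x / 2) ^ 2) ∂μ ≤ 4 := by
    intro t ht
    have e : ∀ x, x ^ 2 * Real.sinc (t * x / 2) ^ 2 = 2 / t ^ 2 * (1 - Real.cos (t * x)) := by
      intro x
      by_cases hx : x = 0
      · simp [hx]
      · rw [Real.sinc_of_ne_zero (by positivity)]
        have := Real.cos_sq' (t * x / 2)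
        have h2 := Real.cos_two_mul (t * x / 2)
        rw [show 2 * (t * x / 2) = t * x by ring] at h2
        rw [h2, this]
        field_simp
        ring
    simp_rw [e]
    have hI : Integrable (fun x => 2 / t ^ 2 * (1 - Real.cos (t * x))) μ :=
      ((integrable_const _).sub (hcosi t)).const_mul _
    rw [← ofReal_integral_eq_lintegral_ofReal hI (ae_of_all _ fun x => by
      have := Real.cos_le_one (t * x)
      have : 0 ≤ 1 - Real.cos (t * x) := by linarith
      positivity)]
    rw [integral_const_mul, integral_sub (integrable_const _) (hcosi t), hcos]
    rw [show (4 : ENNReal) = ENNReal.ofReal 4 by simp]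
    apply ENNReal.ofReal_le_ofReal
    have h2 := hφ2 t
    have h3 : 0 < t ^ 2 := by positivity
    simp
    rw [div_mul_eq_mul_div, div_le_iff₀ h3]
    linarith
  have hlim : ∀ x : ℝ, Tendsto (fun n : ℕ => ENNReal.ofReal
      (x ^ 2 * Real.sinc ((1 / ((n : ℝ) + 1)) * x / 2) ^ 2)) atTop (nhds (ENNReal.ofReal (x ^ 2))) := by
    intro x
    have hcont : Continuous (fun t : ℝ => ENNReal.ofReal (x ^ 2 * Real.sinc (t * x / 2) ^ 2)) := by
      have := Real.continuous_sinc
      exact ENNReal.continuous_ofReal.comp (by fun_prop)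
    have := (hcont.tendsto 0).comp (tendsto_one_div_add_atTop_nhds_zero_nat (𝕜 := ℝ))
    simpa [Function.comp_def] using this
  calc ∫⁻ x, ENNReal.ofReal (x ^ 2) ∂μ
      = ∫⁻ x, liminf (fun n : ℕ => ENNReal.ofReal
          (x ^ 2 * Real.sinc ((1 / ((n : ℝ) + 1)) * x / 2) ^ 2)) atTop ∂μ := by
        congr 1 with x
        exact (hlim x).liminf_eq.symm
    _ ≤ liminf (fun n : ℕ => ∫⁻ x, ENNReal.ofReal
          (x ^ 2 * Real.sinc ((1 / ((n : ℝ) + 1)) * x / 2) ^ 2) ∂μ) atTop := by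
        apply lintegral_liminf_le
        intro n
        have := Real.continuous_sinc
        fun_prop
    _ ≤ 4 := by
        refine liminf_le_of_le (by isBoundedDefault) fun b hb => ?_
        obtain ⟨n, hn⟩ := hb.exists
        exact hn.trans (hbd _ (by positivity))

lemma prof_second_moment (h : μ = halfSum μ ∗ lapM) (hm : ∫⁻ x, ENNReal.ofReal (x ^ 2) ∂μ ≤ 4) :
    Integrable (fun ξ => ξ ^ 2 * prof μ ξ) ∧ ∫ ξ, ξ ^ 2 * prof μ ξ ≤ 4 := by
  have hc := prof_cont μ
  have hn : ∀ ξ, 0 ≤ ξ ^ 2 * prof μ ξ := fun ξ => mul_nonneg (sq_nonneg _) (prof_nonneg μ ξ)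
  have e : ∫⁻ ξ, ENNReal.ofReal (ξ ^ 2 * prof μ ξ) ≤ 4 := by
    rw [prof_withDensity h, lintegral_withDensity_eq_lintegral_mul _ (by fun_prop) (by fun_prop)] at hm
    refine le_trans (le_of_eq ?_) hm
    congr 1 with ξ
    rw [ENNReal.ofReal_mul (sq_nonneg _), mul_comm]
    rfl
  have hi : Integrable (fun ξ => ξ ^ 2 * prof μ ξ) := by
    refine ⟨by fun_prop, ?_⟩
    rw [hasFiniteIntegral_iff_ofReal (ae_of_all _ hn)]
    exact e.trans_lt (by simp)
  refine ⟨hi, ?_⟩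
  rw [integral_eq_lintegral_of_nonneg_ae (ae_of_all _ hn) hi.1]
  exact ENNReal.toReal_le_of_le_ofReal (by norm_num) (by simpa using e)

end Profile

/-- Existence of a smooth, even, nonnegative peak profile solving the rescaled
stationary equation 0 = F'' + 2 (F∗̃F) - F with unit mass and second moment ≤ 4. -/
theorem exists_stationary_peak_profile :
    ∃ F : ℝ → ℝ,
      ContDiff ℝ 2 F ∧
      (∀ ξ, 0 ≤ F ξ) ∧
      (∀ ξ, F (-ξ) = F ξ) ∧
      MeasureTheory.Integrable F ∧
      (∀ ξ₁ ξ₂ : ℝ, |F ξ₁ - F ξ₂| ≤ (1/2) * |ξ₁ - ξ₂|) ∧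
      (∫ ξ : ℝ, F ξ) = 1 ∧
      MeasureTheory.Integrable (fun ξ : ℝ => ξ^2 * F ξ) ∧
      (∫ ξ : ℝ, ξ^2 * F ξ) ≤ 4 ∧
      ∀ ξ : ℝ, 0 = deriv (deriv F) ξ + 2 * (∫ ζ : ℝ, F (2*ξ - ζ) * F ζ) - F ξ := by
  obtain ⟨μ, φ, hμ, hφ, hφ2, h⟩ := exists_fixed_measure
  obtain ⟨hi, h1⟩ := prof_integral h
  obtain ⟨hm1, hm2⟩ := prof_second_moment h (second_moment hφ hφ2)
  obtain ⟨F', d1, d2⟩ := ode_kernel (gain μ) (gain_cont h) (gain_bound h)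
  have hF : (fun x => ∫ y, lapG (x - y) * gain μ y) = prof μ := by
    ext x; exact (prof_eq h x).symm
  rw [hF] at d1
  simp_rw [← prof_eq h] at d2
  have e1 : deriv (prof μ) = F' := funext fun x => (d1 x).deriv
  have e2 : deriv F' = fun x => prof μ x - gain μ x := funext fun x => (d2 x).deriv
  refine ⟨prof μ, ?_, prof_nonneg μ, prof_even μ hφ, hi, prof_lip μ, h1, hm1, hm2, fun ξ => ?_⟩
  · rw [show (2 : WithTop ℕ∞) = 1 + 1 by norm_num, contDiff_succ_iff_deriv]
    refine ⟨fun x => (d1 x).differentiableAt, by simp, ?_⟩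
    rw [e1, contDiff_one_iff_deriv, e2]
    exact ⟨fun x => (d2 x).differentiableAt, (prof_cont μ).sub (gain_cont h)⟩
  · rw [e1, e2]
    simp only [gain]
    ring
end
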